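/- arXiv:1905.10277 — 12 statements merged into one kernel-verified Lean document; each statement's English description precedes it below -/
import Mathlib

section
/- For monoids M and N (in universe u), the category of right M-sets is equivalent to the category of right N-sets if and only if the category of right Mᵐᵒᵖ-sets is equivalent to the category of right Nᵐᵒᵖ-sets. In other words, there is no distinction between `left' and `right' Morita equivalence of monoids: Nonempty (PSh(M) ≌ PSh(N)) ↔ Nonempty (PSh(Mᵐᵒᵖ) ≌ PSh(Nᵐᵒᵖ)). -/
open CategoryTheory

universe u

/-- The category of right `M`-sets, realized as presheaves on the one-object category
associated to the monoid `M`. -/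
abbrev PSh (M : Type u) [Monoid M] : Type (u + 1) :=
  (SingleObj M)ᵒᵖ ⥤ Type u

open CategoryTheory.Limits CategoryTheory.Idempotents Opposite

/-- Objects such that every map to a colimit factors through a leg. -/
def ConnProj {A : Type (u + 1)} [Category.{u} A] : ObjectProperty A := fun P =>
  ∀ (J : Type u) [SmallCategory J] (F : J ⥤ A) (c : Cocone F) (_ : IsColimit c) (f : P ⟶ c.pt),
    ∃ (j : J) (g : P ⟶ F.obj j), g ≫ c.ι.app j = f

theorem ConnProj.map {A B : Type (u + 1)} [Category.{u} A] [Category.{u} B] (e : A ≌ B) {P : A}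
    (h : ConnProj P) : ConnProj (e.functor.obj P) := by
  intro J _ F c hc f
  obtain ⟨j, g, hg⟩ := h J (F ⋙ e.inverse) (e.inverse.mapCocone c)
    (isColimitOfPreserves e.inverse hc) (e.unit.app P ≫ e.inverse.map f)
  refine ⟨j, e.functor.map g ≫ e.counit.app _, ?_⟩
  apply e.inverse.map_injective
  have h2 : e.unit.app P ≫ e.inverse.map
      ((e.functor.map g ≫ e.counit.app (F.obj j)) ≫ c.ι.app j)
      = e.unit.app P ≫ e.inverse.map f := by
    rw [← hg]
    simp
  exact (cancel_epi _).1 h2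

theorem connProj_uliftYoneda {M : Type u} [Monoid M] (X : SingleObj M) :
    ConnProj (A := PSh M) (uliftYoneda.{u}.obj X) := by
  intro J _ F c hc f
  obtain ⟨j, y, hy⟩ := Types.jointly_surjective _
    (isColimitOfPreserves ((evaluation _ _).obj (op X)) hc) (uliftYonedaEquiv f)
  refine ⟨j, uliftYonedaEquiv.symm y, ?_⟩
  apply uliftYonedaEquiv.injective
  rw [uliftYonedaEquiv_comp, Equiv.apply_symm_apply]
  exact hy

theorem ConnProj.retract {M : Type u} [Monoid M] {P : PSh M} (h : ConnProj P) :
    ∃ X : SingleObj M, Nonempty (Retract P (uliftYoneda.{u}.obj X)) := by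
  obtain ⟨j, g, hg⟩ := h _ _ _ (Presheaf.colimitOfRepresentable.{u} P) (𝟙 P)
  exact ⟨_, ⟨⟨g, _, hg⟩⟩⟩

instance : IsIdempotentComplete (Type u) :=
  (isIdempotentComplete_iff_hasEqualizer_of_id_and_idempotent _).2 fun _ _ _ => inferInstance

section
variable {C : Type*} {T : Type*} [Category.{u} C] [Category.{u} T]

theorem isEquivalence_ext (i : C ⥤ T) [i.Full] [i.Faithful]
    (hi : ∀ P : T, ∃ X : C, Nonempty (Retract P (i.obj X))) :
    ((functorExtension₂ C T).obj i).IsEquivalence where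
  faithful := ⟨fun {P Q} f g h => by
    ext
    exact i.map_injective (congrArg Karoubi.Hom.f h)⟩
  full := ⟨fun {P Q} f => by
    let f' : i.obj P.X ⟶ i.obj Q.X := f.f
    have hf : i.map P.p ≫ f' ≫ i.map Q.p = f' := f.comm
    refine ⟨⟨i.preimage f', ?_⟩, ?_⟩
    · apply i.map_injective
      simpa using hf
    · apply Karoubi.hom_ext
      exact i.map_preimage f'⟩
  essSurj := ⟨fun Q => by
    obtain ⟨X, ⟨r⟩⟩ := hi Q.X
    have h1 : r.i ≫ r.r = 𝟙 _ := r.retract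
    have e1 : (r.r ≫ Q.p ≫ r.i) ≫ (r.r ≫ Q.p) ≫ Q.p = r.r ≫ Q.p := by
      simp [reassoc_of% h1]
    have e2 : Q.p ≫ (Q.p ≫ r.i) ≫ r.r ≫ Q.p ≫ r.i = Q.p ≫ r.i := by
      simp [reassoc_of% h1]
    have e3 : (r.r ≫ Q.p) ≫ Q.p ≫ r.i = r.r ≫ Q.p ≫ r.i := by
      simp
    have e4 : (Q.p ≫ r.i) ≫ r.r ≫ Q.p = Q.p := by
      simp [reassoc_of% h1]
    have e5 : i.map (i.preimage (r.r ≫ Q.p ≫ r.i)) = r.r ≫ Q.p ≫ r.i := i.map_preimage _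
    refine ⟨⟨X, i.preimage (r.r ≫ Q.p ≫ r.i), ?_⟩, ⟨⟨⟨r.r ≫ Q.p, ?_⟩, ⟨Q.p ≫ r.i, ?_⟩, ?_, ?_⟩⟩⟩
    · apply i.map_injective
      simp [reassoc_of% h1]
    · rw [← e5] at e1
      exact e1
    · rw [← e5] at e2
      exact e2
    · apply Karoubi.hom_ext
      exact e3.trans e5.symm
    · apply Karoubi.hom_ext
      exact e4⟩

theorem copresheaf_equiv (i : C ⥤ T) [i.Full] [i.Faithful]
    (hi : ∀ P : T, ∃ X : C, Nonempty (Retract P (i.obj X))) :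
    Nonempty ((C ⥤ Type u) ≌ (T ⥤ Type u)) := by
  have := isEquivalence_ext i hi
  exact ⟨(karoubiUniversal C (Type u)).trans
    ((((functorExtension₂ C T).obj i).asEquivalence.congrLeft).trans
      (karoubiUniversal T (Type u)).symm)⟩
end

theorem copsh_equiv {M N : Type u} [Monoid M] [Monoid N] (e : PSh M ≌ PSh N) :
    Nonempty ((SingleObj M ⥤ Type u) ≌ (SingleObj N ⥤ Type u)) := by
  let T := (ConnProj (A := PSh M)).FullSubcategory
  let i : SingleObj M ⥤ T := ConnProj.lift uliftYoneda.{u} connProj_uliftYoneda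
  let j : SingleObj N ⥤ T := ConnProj.lift (uliftYoneda.{u} ⋙ e.inverse)
    (fun X => (connProj_uliftYoneda X).map e.symm)
  obtain ⟨a⟩ := copresheaf_equiv i (fun P => by
    obtain ⟨X, ⟨r⟩⟩ := P.property.retract
    exact ⟨X, ⟨⟨ObjectProperty.homMk r.i, ObjectProperty.homMk r.r, by
      ext1; exact r.retract⟩⟩⟩)
  obtain ⟨b⟩ := copresheaf_equiv j (fun P => by
    obtain ⟨X, ⟨r⟩⟩ := (P.property.map e).retract
    refine ⟨X, ⟨⟨ObjectProperty.homMk (e.unit.app _ ≫ e.inverse.map r.i),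
      ObjectProperty.homMk (e.inverse.map r.r ≫ e.unitInv.app _), ?_⟩⟩⟩
    ext1
    change (e.unit.app _ ≫ e.inverse.map r.i) ≫ e.inverse.map r.r ≫ e.unitInv.app _ = 𝟙 _
    rw [Category.assoc, ← e.inverse.map_comp_assoc, r.retract]
    simp)
  exact ⟨a.trans b.symm⟩

/-- The opposite of `SingleObj Mᵐᵒᵖ` is `SingleObj M`. -/
def singleObjOp (M : Type u) [Monoid M] : (SingleObj Mᵐᵒᵖ)ᵒᵖ ≌ SingleObj M where
  functor :=
    { obj := fun _ => SingleObj.star M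
      map := fun f => MulOpposite.unop (α := M) f.unop
      map_id := fun _ => rfl
      map_comp := fun _ _ => rfl }
  inverse :=
    { obj := fun _ => op (SingleObj.star _)
      map := fun f => Quiver.Hom.op (MulOpposite.op (α := M) f : SingleObj.star Mᵐᵒᵖ ⟶ _)
      map_id := fun _ => rfl
      map_comp := fun _ _ => rfl }
  unitIso := Iso.refl _
  counitIso := Iso.refl _
  functor_unitIso_comp := fun _ => one_mul (1 : M)

theorem psh_forward {M N : Type u} [Monoid M] [Monoid N] (e : PSh M ≌ PSh N) :
    Nonempty (PSh Mᵐᵒᵖ ≌ PSh Nᵐᵒᵖ) := by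
  obtain ⟨a⟩ := copsh_equiv e
  exact ⟨(singleObjOp M).congrLeft.trans (a.trans (singleObjOp N).congrLeft.symm)⟩

/-- Double opposite. -/
def opopEquiv (M : Type u) [Monoid M] : M ≃* Mᵐᵒᵖᵐᵒᵖ where
  toFun x := .op (.op x)
  invFun x := x.unop.unop
  left_inv _ := rfl
  right_inv _ := rfl
  map_mul' _ _ := rfl

/-- There is no distinction between left and right Morita equivalence of monoids:
the categories of right `M`-sets and right `N`-sets are equivalent if and only if the
categories of right `Mᵐᵒᵖ`-sets and right `Nᵐᵒᵖ`-sets are equivalent. -/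
theorem psh_equiv_iff_psh_mulOpposite_equiv (M N : Type u) [Monoid M] [Monoid N] :
    Nonempty (PSh M ≌ PSh N) ↔ Nonempty (PSh Mᵐᵒᵖ ≌ PSh Nᵐᵒᵖ) := by
  refine ⟨fun ⟨e⟩ => psh_forward e, fun ⟨e⟩ => ?_⟩
  obtain ⟨a⟩ := psh_forward e
  exact ⟨((opopEquiv M).toSingleObjEquiv.op.congrLeft).trans
    (a.trans (opopEquiv N).toSingleObjEquiv.op.congrLeft.symm)⟩
end

section
/- Let P be a preorder, regarded as a category, and let M be a monoid. The presheaf category Pᵒᵖ ⥤ Type u is equivalent to the category of right M-sets if and only if P is equivalent to the one-element poset and M is trivial; precisely, Nonempty ((Pᵒᵖ ⥤ Type u) ≌ PSh(M)) ↔ (Nonempty P ∧ (∀ p q : P, p ≤ q) ∧ Subsingleton M). -/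
open CategoryTheory

universe u

namespace PreorderPsh

open CategoryTheory Opposite Limits

universe w

/-- constant presheaf on a point is terminal -/
def constTerminal (C : Type w) [Category.{u} C] :
    IsTerminal ((Functor.const Cᵒᵖ).obj (PUnit.{u+1}) : Cᵒᵖ ⥤ Type u) :=
  IsTerminal.ofUniqueHom
    (fun X => { app := fun _ => ↾(fun _ => PUnit.unit), naturality := by intros; ext; rfl })
    (fun X m => by ext; rfl)

/-- the two points of the constant presheaf on a two-element set -/
def pt (C : Type w) [Category.{u} C] (X : Cᵒᵖ ⥤ Type u) (b : Bool) :
    X ⟶ (Functor.const Cᵒᵖ).obj (ULift.{u} Bool) :=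
  { app := fun _ => ↾(fun _ => ULift.up b), naturality := by intros; ext; rfl }

lemma pt_ne (C : Type w) [Category.{u} C] (X : Cᵒᵖ ⥤ Type u) (c : Cᵒᵖ) (x : X.obj c)
    (h : pt C X true = pt C X false) : False := by
  have h1 : (pt C X true).app c x = (pt C X false).app c x := by rw [h]
  have h2 : ULift.up.{u} true = ULift.up false := h1
  simp at h2

lemma subsingleton_of_terminal (C : Type w) [Category.{u} C] (X : Cᵒᵖ ⥤ Type u)
    (hX : IsTerminal X) (c : Cᵒᵖ) : Subsingleton (X.obj c) := by
  let i := (hX.uniqueUpToIso (constTerminal C)).app c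
  have : Function.Injective (i.hom : _ → _) := i.toEquiv.injective
  exact ⟨fun a b => this (Subsingleton.elim (α := PUnit) _ _)⟩

variable (M : Type u) [Monoid M]

/-- power set of `M` with its right action -/
def powM : PSh M where
  obj _ := Set M
  map k := ↾(fun S => {n : M | ((k.unop : M) * n) ∈ S})
  map_id _ := by
    ext S n
    change (1 : M) * n ∈ S ↔ n ∈ S
    rw [one_mul]
  map_comp f g := by
    ext S n
    change ((f.unop : M) * (g.unop : M)) * n ∈ S ↔ (f.unop : M) * ((g.unop : M) * n) ∈ S
    rw [mul_assoc]

/-- the map `M ⟶ powM` given by a subset -/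
def chi (S : Set M) : (yoneda.obj (SingleObj.star M) : PSh M) ⟶ powM M where
  app _ := ↾(fun x => {n : M | (show M from x) * n ∈ S})
  naturality X Y f := by
    ext x
    apply Set.ext
    intro n
    change (((show M from x) * (show M from f.unop)) * n ∈ S) ↔
      ((show M from x) * ((show M from f.unop) * n) ∈ S)
    rw [mul_assoc]

theorem bwd (P : Type u) [Preorder P] (h0 : Nonempty P) (h : ∀ p q : P, p ≤ q)
    (hM : Subsingleton M) : Nonempty ((Pᵒᵖ ⥤ Type u) ≌ PSh M) := by
  have sub : ∀ X Y : SingleObj M, Subsingleton (X ⟶ Y) := fun _ _ => hM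
  let G : P ⥤ SingleObj M :=
    { obj := fun _ => SingleObj.star M
      map := fun _ => 𝟙 _
      map_id := fun _ => rfl
      map_comp := fun _ _ => Subsingleton.elim _ _ }
  have : G.Full := ⟨fun {X Y} f => ⟨homOfLE (h X Y), Subsingleton.elim _ _⟩⟩
  have : G.Faithful := ⟨fun _ => Subsingleton.elim _ _⟩
  have : G.EssSurj := ⟨fun Y => ⟨h0.some, ⟨eqToIso rfl⟩⟩⟩
  have : G.IsEquivalence := {}
  exact ⟨G.asEquivalence.op.congrLeft⟩

theorem fwd (P : Type u) [Preorder P] (e : (Pᵒᵖ ⥤ Type u) ≌ PSh M) :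
    Nonempty P ∧ (∀ p q : P, p ≤ q) ∧ Subsingleton M := by
  have h0 : Nonempty P := by
    by_contra hP
    rw [not_nonempty_iff] at hP
    refine pt_ne (SingleObj M) ((Functor.const _).obj PUnit) (op (SingleObj.star M))
      PUnit.unit (e.inverse.map_injective ?_)
    ext q
    exact hP.elim q.unop
  have hne : ∀ p : P, Nonempty ((e.functor.obj (yoneda.obj p)).obj (op (SingleObj.star M))) := by
    intro p
    by_contra hp
    rw [not_nonempty_iff] at hp
    refine pt_ne P (yoneda.obj p) (op p) (𝟙 p) (e.functor.map_injective ?_)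
    ext q x
    exact hp.elim x
  have hle : ∀ p q : P, p ≤ q := by
    intro q p
    let t := (constTerminal P).from (yoneda.obj p)
    have : Epi (e.functor.map t) := by
      rw [NatTrans.epi_iff_epi_app]
      intro c
      rw [epi_iff_surjective]
      intro y
      have := subsingleton_of_terminal _ _ ((constTerminal P).isTerminalObj e.functor) c
      exact ⟨(hne p).some, Subsingleton.elim _ _⟩
    have : Epi t := e.functor.epi_of_epi_map this
    rw [NatTrans.epi_iff_epi_app] at this
    have := this (op q)
    rw [epi_iff_surjective] at this
    obtain ⟨x, -⟩ := this PUnit.unit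
    exact leOfHom x
  refine ⟨h0, hle, ?_⟩
  have hy : ∀ p : P, IsTerminal (yoneda.obj p) := fun p =>
    IsTerminal.ofUniqueHom
      (fun X => { app := fun q => ↾(fun _ => homOfLE (hle _ _)),
                  naturality := by intros; ext; exact Subsingleton.elim (α := (_ ⟶ p)) _ _ })
      (fun X m => by ext; exact Subsingleton.elim (α := (_ ⟶ p)) _ _)
  let S : Set M := {z | ∀ m : M, z * m = z}
  have key : chi M S = chi M Set.univ := by
    apply e.inverse.map_injective
    ext q x
    let k := yonedaEquiv.symm x
    let h : e.functor.obj (yoneda.obj q.unop) ⟶ yoneda.obj (SingleObj.star M) :=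
      e.functor.map k ≫ e.counit.app _
    have hh : h ≫ chi M S = h ≫ chi M Set.univ := by
      ext c t
      have hs := subsingleton_of_terminal _ _ ((hy q.unop).isTerminalObj e.functor) c
      have hz : (show M from h.app c t) ∈ S := by
        intro m
        have := NatTrans.naturality_apply h (X := c) (Y := c) (Quiver.Hom.op (show c.unop ⟶ c.unop from m)) t
        rw [Subsingleton.elim ((e.functor.obj (yoneda.obj q.unop)).map _ t) t] at this
        exact this.symm
      change {n : M | (show M from h.app c t) * n ∈ S} =
        {n : M | (show M from h.app c t) * n ∈ Set.univ}
      ext n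
      simp only [Set.mem_ofPred_eq, Set.mem_univ, iff_true]
      rw [hz n]
      exact hz
    have hk : k ≫ e.inverse.map (chi M S) = k ≫ e.inverse.map (chi M Set.univ) := by
      apply e.functor.map_injective
      rw [← cancel_mono (e.counit.app _)]
      simpa [h] using hh
    have := congrArg yonedaEquiv hk
    rw [yonedaEquiv_comp, yonedaEquiv_comp] at this
    simp only [k, Equiv.apply_symm_apply] at this
    exact this
  have h1 : (chi M S).app (op (SingleObj.star M)) (1 : M) =
    (chi M Set.univ).app (op (SingleObj.star M)) (1 : M) := by rw [key]
  have h2 : {n : M | (1 : M) * n ∈ S} = {n : M | (1 : M) * n ∈ Set.univ} := h1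
  have h3 : (1 : M) ∈ {n : M | (1 : M) * n ∈ S} := by rw [h2]; trivial
  have h4 : ∀ m : M, (1 * 1 : M) * m = 1 * 1 := h3
  simp only [one_mul] at h4
  exact ⟨fun a b => by rw [h4 a, h4 b]⟩

end PreorderPsh

/-- For a preorder `P` (regarded as a category) and a monoid `M`, the presheaf category
on `P` is equivalent to the category of right `M`-sets if and only if `P` is equivalent
to the one-element poset (i.e. `P` is nonempty and any two elements are comparable via
`≤` in both directions) and `M` is trivial. -/
theorem preorder_presheaves_equiv_psh_iff (P : Type u) [Preorder P] (M : Type u) [Monoid M] :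
    Nonempty ((Pᵒᵖ ⥤ Type u) ≌ PSh M) ↔
      (Nonempty P ∧ (∀ p q : P, p ≤ q) ∧ Subsingleton M) := by
  constructor
  · rintro ⟨e⟩
    exact PreorderPsh.fwd M P e
  · rintro ⟨h0, h, hM⟩
    exact PreorderPsh.bwd M P h0 h hM
end

section
/- Let M be a monoid and let b, b' : M satisfy b * b' = 1. Then for every natural number n, the element eₙ := b'^n * b^n is idempotent; for all n ≥ m one has eₙ * eₘ = eₙ and eₘ * eₙ = eₙ; and if eₙ₊₁ = eₙ for some n, then b' * b = 1 (so b is invertible). -/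
universe u

/-- Let `b, b'` be elements of a monoid `M` with `b * b' = 1`. Then each
`eₙ := b'^n * b^n` is idempotent; `eₙ * eₘ = eₙ = eₘ * eₙ` whenever `n ≥ m`; and if
`eₙ₊₁ = eₙ` for some `n`, then `b' * b = 1`, so that `b` is invertible. -/
theorem descending_chain_of_idempotents (M : Type u) [Monoid M] (b b' : M)
    (h : b * b' = 1) :
    (∀ n : ℕ, (b' ^ n * b ^ n) * (b' ^ n * b ^ n) = b' ^ n * b ^ n) ∧
    (∀ m n : ℕ, m ≤ n →
      (b' ^ n * b ^ n) * (b' ^ m * b ^ m) = b' ^ n * b ^ n ∧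
      (b' ^ m * b ^ m) * (b' ^ n * b ^ n) = b' ^ n * b ^ n) ∧
    (∀ n : ℕ, b' ^ (n + 1) * b ^ (n + 1) = b' ^ n * b ^ n → b' * b = 1) := by
  have key : ∀ n : ℕ, b ^ n * b' ^ n = 1 := fun n => pow_mul_pow_eq_one n h
  have k2 : ∀ (n : ℕ) (x : M), b ^ n * (b' ^ n * x) = x := fun n x => by
    rw [← mul_assoc, key, one_mul]
  refine ⟨fun n => ?_, fun m n hmn => ?_, fun n hn => ?_⟩
  · rw [mul_assoc, k2]
  · obtain ⟨k, rfl⟩ := Nat.exists_eq_add_of_le hmn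
    constructor
    · have e : b ^ (m + k) = b ^ k * b ^ m := by rw [add_comm, pow_add]
      rw [e]
      simp only [mul_assoc, k2]
    · rw [pow_add b' m k]
      simp only [mul_assoc, k2]
  · rw [pow_succ b', pow_succ' b] at hn
    have h2 := congrArg (fun x => b ^ n * x * b' ^ n) hn
    simpa only [mul_assoc, k2, key, mul_one] using h2
end

section
/- Let C be a small category and Q an object of the presheaf category Cᵒᵖ ⥤ Type u. The functor Hom(Q, −) : (Cᵒᵖ ⥤ Type u) ⥤ Type u (the coyoneda functor at Q) has a right adjoint (equivalently, Hom(Q,−) preserves all small colimits, so that Q induces an essential point of the presheaf topos) if and only if Q is projective and indecomposable. -/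
open CategoryTheory CategoryTheory.Limits

universe u

/-- An object `Q` of a category with binary coproducts is *indecomposable* if it is not
initial and whenever `Q` is isomorphic to a coproduct `A ⨿ B`, one of the two coproduct
injections is an isomorphism. -/
def Indecomposable {C : Type*} [Category C] [HasBinaryCoproducts C] (Q : C) : Prop :=
  (IsInitial Q → False) ∧
    ∀ A B : C, Nonempty (Q ≅ A ⨿ B) →
      IsIso (coprod.inl : A ⟶ A ⨿ B) ∨ IsIso (coprod.inr : B ⟶ A ⨿ B)

lemma preservesColimit_of_retract_aux {D : Type*} [Category D] {E : Type*} [Category E]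
    {F G : D ⥤ E} (i : F ⟶ G) (r : G ⟶ F) (h : i ≫ r = 𝟙 F)
    {J : Type*} [Category J] (K : J ⥤ D) [PreservesColimit K G] : PreservesColimit K F := by
  have hX : ∀ X, i.app X ≫ r.app X = 𝟙 _ := fun X => by
    rw [← NatTrans.comp_app, h, NatTrans.id_app]
  have n1 : ∀ {X Y : D} {Z : E} (f : X ⟶ Y) (g : G.obj Y ⟶ Z) (g' : G.obj X ⟶ Z)
      (k : F.obj X ⟶ Z), G.map f ≫ g = g' → i.app X ≫ g' = k → F.map f ≫ i.app Y ≫ g = k := by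
    intro X Y Z f g g' k h1 h2
    rw [NatTrans.naturality_assoc, h1, h2]
  have n2 : ∀ {X : D} {Z : E} (g : F.obj X ⟶ Z), i.app X ≫ r.app X ≫ g = g := by
    intro X Z g
    rw [← Category.assoc, hX, Category.id_comp]
  constructor
  intro c hc
  have hG := isColimitOfPreserves G hc
  let t (s : Cocone (K ⋙ F)) : Cocone (K ⋙ G) :=
    { pt := s.pt
      ι := Functor.whiskerLeft K r ≫ s.ι }
  refine ⟨{ desc := fun s => i.app c.pt ≫ hG.desc (t s), fac := ?_, uniq := ?_ }⟩
  · intro s j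
    have h1 : G.map (c.ι.app j) ≫ hG.desc (t s) = r.app (K.obj j) ≫ s.ι.app j :=
      hG.fac (t s) j
    exact n1 _ _ _ _ h1 (n2 _)
  · intro s m hm
    have h2 : r.app c.pt ≫ m = hG.desc (t s) := by
      refine hG.uniq (t s) _ fun j => ?_
      exact (r.naturality_assoc (c.ι.app j) m).trans
        (congrArg (fun y => r.app (K.obj j) ≫ y) (hm j))
    exact (n2 m).symm.trans (congrArg (fun y => i.app c.pt ≫ y) h2)

/-- The coproduct of representables covering a presheaf. -/
def coverAux {C : Type u} [SmallCategory C] (Q : Cᵒᵖ ⥤ Type u) : Cᵒᵖ ⥤ Type u where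
  obj c := Σ p : (Σ d : C, Q.obj (Opposite.op d)), (c.unop ⟶ p.1)
  map f := ↾fun x => ⟨x.1, f.unop ≫ x.2⟩

/-- The covering map. -/
def coverAuxπ {C : Type u} [SmallCategory C] (Q : Cᵒᵖ ⥤ Type u) : coverAux Q ⟶ Q where
  app c := ↾fun x => Q.map x.2.op x.1.2
  naturality c d f := by
    ext x
    change Q.map (f.unop ≫ x.2).op x.1.2 = Q.map f (Q.map x.2.op x.1.2)
    rw [op_comp, Functor.map_comp]
    rfl

instance {C : Type u} [SmallCategory C] (Q : Cᵒᵖ ⥤ Type u) : Epi (coverAuxπ Q) := by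
  rw [NatTrans.epi_iff_epi_app]
  intro c
  rw [epi_iff_surjective]
  intro x
  exact ⟨⟨⟨c.unop, x⟩, 𝟙 _⟩, by simp [coverAuxπ]⟩

/-- A presheaf is the coproduct of a subpresheaf and a complementary one. -/
lemma coprodIsoAux {C : Type u} [SmallCategory C] {Q : Cᵒᵖ ⥤ Type u} (A B : Subfunctor Q)
    (h : ∀ c x, x ∈ B.obj c ↔ x ∉ A.obj c) :
    ∃ e : A.toFunctor ⨿ B.toFunctor ≅ Q, coprod.inl ≫ e.hom = A.ι ∧ coprod.inr ≫ e.hom = B.ι := by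
  have : IsIso (coprod.desc A.ι B.ι) := by
    classical
    rw [NatTrans.isIso_iff_isIso_app]
    intro c
    let g : Q.obj c ⟶ (A.toFunctor ⨿ B.toFunctor).obj c := ↾fun x =>
      if hx : x ∈ A.obj c then (coprod.inl : A.toFunctor ⟶ A.toFunctor ⨿ B.toFunctor).app c ⟨x, hx⟩
      else (coprod.inr : B.toFunctor ⟶ A.toFunctor ⨿ B.toFunctor).app c ⟨x, (h c x).2 hx⟩
    have e1 : ∀ a, (coprod.desc A.ι B.ι).app c
        ((coprod.inl : A.toFunctor ⟶ A.toFunctor ⨿ B.toFunctor).app c a) = a.1 := fun a =>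
      ConcreteCategory.congr_hom (congr_app (coprod.inl_desc A.ι B.ι) c) a
    have e2 : ∀ a, (coprod.desc A.ι B.ι).app c
        ((coprod.inr : B.toFunctor ⟶ A.toFunctor ⨿ B.toFunctor).app c a) = a.1 := fun a =>
      ConcreteCategory.congr_hom (congr_app (coprod.inr_desc A.ι B.ι) c) a
    refine ⟨g, ?_, ?_⟩
    · have hc := isColimitOfPreserves ((evaluation _ _).obj c)
        (colimit.isColimit (pair A.toFunctor B.toFunctor))
      refine hc.hom_ext ?_
      rintro ⟨_ | _⟩
      · ext a
        refine (congrArg g (e1 a)).trans ?_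
        have : a.1 ∈ A.obj c := a.2
        simp [g, this]
        rfl
      · ext a
        refine (congrArg g (e2 a)).trans ?_
        have : a.1 ∉ A.obj c := (h _ _).1 a.2
        simp [g, this]
        rfl
    · ext x
      by_cases hx : x ∈ A.obj c
      · simpa [g, hx] using e1 ⟨x, hx⟩
      · simpa [g, hx] using e2 ⟨x, (h c x).2 hx⟩
  exact ⟨asIso (coprod.desc A.ι B.ι), coprod.inl_desc _ _, coprod.inr_desc _ _⟩

lemma retract_representable_aux {C : Type u} [SmallCategory C] (Q : Cᵒᵖ ⥤ Type u)
    (hP : Projective Q) (hI : Indecomposable Q) :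
    ∃ (d : C) (q : Q.obj (Opposite.op d)) (i : Q ⟶ yoneda.obj d),
      i ≫ yonedaEquiv.symm q = 𝟙 Q := by
  obtain ⟨s, hs⟩ := hP.factors (𝟙 Q) (coverAuxπ Q)
  have hne : ∃ c, Nonempty (Q.obj c) := by
    by_contra! hne
    refine hI.1 (IsInitial.ofUniqueHom (fun X =>
      { app := fun c => ↾fun x => ((hne c).false x).elim
        naturality := fun c d f => by ext x; exact ((hne c).false x).elim }) ?_)
    intro X m
    ext c x
    exact ((hne c).false x).elim
  obtain ⟨c0, ⟨x0⟩⟩ := hne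
  have nat : ∀ {c d} (f : c ⟶ d) (x : Q.obj c),
      s.app d (Q.map f x) = ⟨(s.app c x).1, f.unop ≫ (s.app c x).2⟩ := fun f x =>
    NatTrans.naturality_apply s f x
  let p0 := (s.app c0 x0).1
  let A : Subfunctor Q :=
    { obj := fun c => {x | (s.app c x).1 = p0}
      map := fun f x hx => by
        change (s.app _ (Q.map f x)).1 = p0
        rw [nat]; exact hx }
  let B : Subfunctor Q :=
    { obj := fun c => {x | (s.app c x).1 ≠ p0}
      map := fun f x hx => by
        change (s.app _ (Q.map f x)).1 ≠ p0
        rw [nat]; exact hx }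
  obtain ⟨e, he1, he2⟩ := coprodIsoAux A B (fun c x => Iff.rfl)
  have key : ∀ c x, (s.app c x).1 = p0 := by
    rcases hI.2 _ _ ⟨e.symm⟩ with h | h
    · have : IsIso A.ι := by rw [← he1]; infer_instance
      intro c x
      obtain ⟨a, ha⟩ := (epi_iff_surjective (A.ι.app c)).1 inferInstance x
      rw [← ha]
      exact a.2
    · have : IsIso B.ι := by rw [← he2]; infer_instance
      obtain ⟨a, ha⟩ := (epi_iff_surjective (B.ι.app c0)).1 inferInstance x0
      have h2 : (s.app c0 a.1).1 ≠ p0 := a.2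
      have h3 : a.1 = x0 := ha
      rw [h3] at h2
      exact (h2 rfl).elim
  have key2 : ∀ c x, ∃ f : c.unop ⟶ p0.1, s.app c x = ⟨p0, f⟩ := by
    intro c x
    have := key c x
    generalize s.app c x = y at this
    obtain ⟨y1, y2⟩ := y
    dsimp only at this
    subst this
    exact ⟨y2, rfl⟩
  choose g hg using key2
  refine ⟨p0.1, p0.2, { app := fun c => ↾fun x => g c x, naturality := ?_ }, ?_⟩
  · intro c d f
    ext x
    have h1 := nat f x
    rw [hg, hg] at h1
    have h2 := eq_of_heq (Sigma.mk.inj h1).2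
    exact h2
  · ext c x
    have h1 : (coverAuxπ Q).app c (s.app c x) = x :=
      ConcreteCategory.congr_hom (congr_app hs c) x
    rw [hg] at h1
    exact h1





/-- For a presheaf `Q` on a small category `C`, the functor `Hom(Q, -)` (the coyoneda
functor at `Q`) has a right adjoint — i.e. `Q` induces an essential point of the presheaf
topos — if and only if `Q` is projective and indecomposable. -/
theorem coyoneda_isLeftAdjoint_iff_projective_indecomposable
    (C : Type u) [SmallCategory C] (Q : Cᵒᵖ ⥤ Type u) :
    (coyoneda.obj (Opposite.op Q)).IsLeftAdjoint ↔
      (Projective Q ∧ Indecomposable Q) := by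

  constructor
  · intro hL
    have hP : Projective Q := by
      rw [Projective.projective_iff_preservesEpimorphisms_coyoneda_obj]
      infer_instance
    refine ⟨hP, fun hQ => ?_, ?_⟩
    · have h := IsInitial.isInitialObj (coyoneda.obj (Opposite.op Q)) Q hQ
      have f : (Q ⟶ Q) ⟶ PEmpty.{u+1} := h.to PEmpty.{u+1}
      exact (f (𝟙 Q)).elim
    · rintro A B ⟨e⟩
      have hc := isColimitOfPreserves (coyoneda.obj (Opposite.op Q))
        (colimit.isColimit (pair A B))
      obtain ⟨⟨j⟩, k, hk⟩ := Types.jointly_surjective_of_isColimit hc e.hom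
      have : MonoCoprod (Cᵒᵖ ⥤ Type u) := inferInstance
      cases j
      · left
        obtain ⟨k, hk'⟩ : ∃ k : Q ⟶ A, k ≫ (coprod.inl : A ⟶ A ⨿ B) = e.hom := ⟨k, hk⟩
        have : IsSplitEpi (coprod.inl : A ⟶ A ⨿ B) :=
          ⟨⟨⟨e.inv ≫ k, by rw [Category.assoc, hk', e.inv_hom_id]⟩⟩⟩
        exact isIso_of_mono_of_isSplitEpi _
      · right
        obtain ⟨k, hk'⟩ : ∃ k : Q ⟶ B, k ≫ (coprod.inr : B ⟶ A ⨿ B) = e.hom := ⟨k, hk⟩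
        have : IsSplitEpi (coprod.inr : B ⟶ A ⨿ B) :=
          ⟨⟨⟨e.inv ≫ k, by rw [Category.assoc, hk', e.inv_hom_id]⟩⟩⟩
        exact isIso_of_mono_of_isSplitEpi _
  · rintro ⟨hP, hI⟩
    obtain ⟨d, q, i, hi⟩ := retract_representable_aux Q hP hI
    let α : coyoneda.obj (Opposite.op Q) ⟶ (evaluation Cᵒᵖ (Type u)).obj (Opposite.op d) :=
      { app := fun X => ↾fun (a : Q ⟶ X) => a.app _ q }
    let β : (evaluation Cᵒᵖ (Type u)).obj (Opposite.op d) ⟶ coyoneda.obj (Opposite.op Q) :=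
      { app := fun X => ↾fun x => i ≫ yonedaEquiv.symm x
        naturality := fun X Y f => by
          ext x
          simp [yonedaEquiv_symm_naturality_right] }
    have h : α ≫ β = 𝟙 _ := by
      ext X a
      change i ≫ yonedaEquiv.symm (a.app _ q) = a
      rw [← yonedaEquiv_symm_naturality_right, ← Category.assoc, hi, Category.id_comp]
    have : PreservesColimitsOfSize.{u, u} (coyoneda.obj (Opposite.op Q)) :=
      ⟨⟨fun {K} => preservesColimit_of_retract_aux α β h K⟩⟩
    exact Presheaf.isLeftAdjoint_of_preservesColimits.{u} _
end

section
/- Let M be a monoid. Every indecomposable projective object Q of the category of right M-sets that is not initial is a retract of the representable presheaf yoneda(⋆) (that is, of M acting on itself by right multiplication); consequently Q is isomorphic to the image of right multiplication by some idempotent e of M. -/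
open CategoryTheory CategoryTheory.Limits

universe u

section Helpers

variable {C : Type*} [Category C]

theorem aux_decomp {Q : C ⥤ Type u} (P N : Subfunctor Q)
    (h : ∀ U (x : Q.obj U), x ∈ N.obj U ↔ x ∉ P.obj U) :
    IsIso (coprod.desc P.ι N.ι) := by
  classical
  let inv : Q ⟶ P.toFunctor ⨿ N.toFunctor :=
    { app := fun U => ↾fun x => if hx : x ∈ P.obj U then
          (coprod.inl : P.toFunctor ⟶ P.toFunctor ⨿ N.toFunctor).app U ⟨x, hx⟩
        else (coprod.inr : N.toFunctor ⟶ P.toFunctor ⨿ N.toFunctor).app U ⟨x, (h U x).2 hx⟩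
      naturality := by
        intro U V f
        ext x
        by_cases hx : x ∈ P.obj U
        · have hy : Q.map f x ∈ P.obj V := P.map f hx
          have := NatTrans.naturality_apply
            (coprod.inl : P.toFunctor ⟶ P.toFunctor ⨿ N.toFunctor) f ⟨x, hx⟩
          simp [hx, hy]
          exact this
        · have hy : Q.map f x ∉ P.obj V := (h V _).1 (N.map f ((h U x).2 hx))
          have := NatTrans.naturality_apply
            (coprod.inr : N.toFunctor ⟶ P.toFunctor ⨿ N.toFunctor) f ⟨x, (h U x).2 hx⟩
          simp [hx, hy]
          exact this }
  refine ⟨inv, ?_, ?_⟩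
  · apply coprod.hom_ext
    · rw [coprod.inl_desc_assoc, Category.comp_id]
      ext U ⟨x, hx⟩
      exact dif_pos hx
    · rw [coprod.inr_desc_assoc, Category.comp_id]
      ext U ⟨x, hx⟩
      exact dif_neg ((h U x).1 hx)
  · ext U x
    by_cases hx : x ∈ P.obj U
    · have e : inv.app U x = (coprod.inl : P.toFunctor ⟶ P.toFunctor ⨿ N.toFunctor).app U ⟨x, hx⟩ :=
        dif_pos hx
      have := ConcreteCategory.congr_hom (NatTrans.congr_app (coprod.inl_desc P.ι N.ι) U) ⟨x, hx⟩
      change (coprod.desc P.ι N.ι).app U (inv.app U x) = x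
      rw [e]
      exact this
    · have hx' := (h U x).2 hx
      have e : inv.app U x = (coprod.inr : N.toFunctor ⟶ P.toFunctor ⨿ N.toFunctor).app U ⟨x, hx'⟩ :=
        dif_neg hx
      have := ConcreteCategory.congr_hom (NatTrans.congr_app (coprod.inr_desc P.ι N.ι) U) ⟨x, hx'⟩
      change (coprod.desc P.ι N.ι).app U (inv.app U x) = x
      rw [e]
      exact this

theorem aux_surj {Q : C ⥤ Type u} (P : Subfunctor Q) (h : IsIso P.ι) (U : C) (x : Q.obj U) :
    x ∈ P.obj U := by
  have : Epi (P.ι.app U) := inferInstance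
  obtain ⟨y, rfl⟩ := (epi_iff_surjective _).1 this x
  exact y.2

theorem aux_indec {Q : C ⥤ Type u} (hQ : Indecomposable Q) (P N : Subfunctor Q)
    (h : ∀ U (x : Q.obj U), x ∈ N.obj U ↔ x ∉ P.obj U) :
    (∀ U (x : Q.obj U), x ∈ P.obj U) ∨ (∀ U (x : Q.obj U), x ∈ N.obj U) := by
  have := aux_decomp P N h
  rcases hQ.2 _ _ ⟨(asIso (coprod.desc P.ι N.ι)).symm⟩ with h1 | h1
  · left
    apply aux_surj
    rw [← coprod.inl_desc P.ι N.ι]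
    infer_instance
  · right
    apply aux_surj
    rw [← coprod.inr_desc P.ι N.ι]
    infer_instance

theorem aux_nonempty {Q : C ⥤ Type u} (hni : IsInitial Q → False) :
    ∃ U, Nonempty (Q.obj U) := by
  by_contra! hc
  refine hni (IsInitial.ofUniqueHom (fun Y => 
    { app := fun U => ↾fun x => ((hc U).false x).elim
      naturality := by
        intro U V f
        ext x
        exact ((hc U).false x).elim }) ?_)
  intro Y m
  ext U x
  exact ((hc U).false x).elim

/-- The free presheaf on copies of a representable, indexed by the sections of `Q`. -/
def auxFree (Y : Cᵒᵖ ⥤ Type u) (S : Type u) : Cᵒᵖ ⥤ Type u where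
  obj U := S × Y.obj U
  map f := ↾fun p => (p.1, Y.map f p.2)
  map_id U := by ext p <;> simp
  map_comp f g := by ext p <;> simp

end Helpers

theorem aux_retract (M : Type u) [Monoid M] (Q : PSh M)
    (hQ : Indecomposable Q) (hproj : Projective Q) (hni : IsInitial Q → False) :
    ∃ (i : Q ⟶ yoneda.obj (SingleObj.star M)) (r : yoneda.obj (SingleObj.star M) ⟶ Q),
      i ≫ r = 𝟙 Q := by
  let Y := yoneda.obj (SingleObj.star M)
  let S := Q.obj (Opposite.op (SingleObj.star M))
  let F : PSh M := auxFree Y S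
  let ev : S → (Y ⟶ Q) := fun s => yonedaEquiv.symm s
  let p : F ⟶ Q :=
    { app := fun U => ↾fun a => (ev a.1).app U a.2
      naturality := by
        intro U V f
        ext a
        exact NatTrans.naturality_apply (ev a.1) f a.2 }
  have hp : Epi p := by
    have : ∀ U, Epi (p.app U) := by
      intro U
      rw [epi_iff_surjective]
      intro x
      refine ⟨((x : S), 𝟙 (SingleObj.star M)), ?_⟩
      exact (yonedaEquiv (F := Q) (X := SingleObj.star M)).apply_symm_apply x
    exact NatTrans.epi_of_epi_app p
  let s : Q ⟶ F := Projective.factorThru (𝟙 Q) p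
  have hs : s ≫ p = 𝟙 Q := Projective.factorThru_comp _ _
  let c : ∀ U, Q.obj U → S := fun U x => (s.app U x).1
  have hc : ∀ U V (f : U ⟶ V) (x : Q.obj U), c V (Q.map f x) = c U x := by
    intro U V f x
    have h1 := NatTrans.naturality_apply s f x
    have h2 := congrArg (fun a : S × Y.obj V => a.1) h1
    exact h2
  obtain ⟨U0, ⟨q0⟩⟩ := aux_nonempty hni
  let P : Subfunctor Q :=
    { obj := fun U => {x | c U x = c U0 q0}
      map := fun {U V} f x hx => (hc U V f x).trans hx }
  let N : Subfunctor Q :=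
    { obj := fun U => {x | c U x ≠ c U0 q0}
      map := fun {U V} f x hx => fun h => hx ((hc U V f x).symm.trans h) }
  have hP : ∀ U (x : Q.obj U), c U x = c U0 q0 := by
    rcases aux_indec hQ P N (fun U x => Iff.rfl) with h | h
    · exact h
    · exact absurd rfl (h U0 q0)
  let i : Q ⟶ Y :=
    { app := fun U => ↾fun x => (s.app U x).2
      naturality := by
        intro U V f
        ext x
        exact congrArg Prod.snd (NatTrans.naturality_apply s f x) }
  refine ⟨i, ev (c U0 q0), ?_⟩
  ext U x
  have h1 : (ev (c U x)).app U (s.app U x).2 = x :=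
    ConcreteCategory.congr_hom (NatTrans.congr_app hs U) x
  rw [hP U x] at h1
  exact h1

/-- Every indecomposable projective non-initial right `M`-set `Q` is a retract of the
representable presheaf at the unique object (i.e. of `M` acting on itself by right
multiplication); consequently, `Q` is isomorphic to the image of right multiplication by
some idempotent `e` of `M` (as an endomorphism of the representable presheaf). -/
theorem indecomposable_projective_retract_of_representable
    (M : Type u) [Monoid M] (Q : PSh M)
    (hQ : Indecomposable Q) (hproj : Projective Q) (hni : IsInitial Q → False) :
    (∃ (i : Q ⟶ yoneda.obj (SingleObj.star M)) (r : yoneda.obj (SingleObj.star M) ⟶ Q),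
      i ≫ r = 𝟙 Q) ∧
    (∃ e : M, e * e = e ∧
      Nonempty (Q ≅ (Subfunctor.range
        (yoneda.map (show SingleObj.star M ⟶ SingleObj.star M from e))).toFunctor)) := by
  obtain ⟨i, r, hir⟩ := aux_retract M Q hQ hproj hni
  refine ⟨⟨i, r, hir⟩, ?_⟩
  obtain ⟨e, he⟩ := yoneda.map_surjective (r ≫ i)
  refine ⟨e, ?_, ?_⟩
  · have h : e ≫ e = e := by
      apply yoneda.map_injective
      rw [Functor.map_comp, he, Category.assoc, reassoc_of% hir]
    exact h
  · change Nonempty (Q ≅ (Subfunctor.range (yoneda.map e)).toFunctor)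
    rw [he]
    have hle : Subfunctor.range i ≤ Subfunctor.range (r ≫ i) := by
      have h2 : i = i ≫ r ≫ i := by rw [reassoc_of% hir]
      conv_lhs => rw [h2]
      exact Subfunctor.range_comp_le i (r ≫ i)
    refine ⟨⟨Subfunctor.lift i hle, (Subfunctor.range (r ≫ i)).ι ≫ r, ?_, ?_⟩⟩
    · rw [Subfunctor.lift_ι_assoc, hir]
    · rw [← cancel_mono (Subfunctor.range (r ≫ i)).ι, ← cancel_epi (Subfunctor.toRange (r ≫ i))]
      simp only [Category.assoc, Subfunctor.lift_ι, Category.id_comp, Subfunctor.toRange_ι,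
        Subfunctor.toRange_ι_assoc]
      rw [reassoc_of% hir]
end

section
/- Let C be a small category and Q an indecomposable projective object of the presheaf category Cᵒᵖ ⥤ Type u. Then the following are equivalent: (1) the functor Hom(Q,−) : (Cᵒᵖ ⥤ Type u) ⥤ Type u is faithful; (2) Hom(Q,−) is conservative (reflects isomorphisms); (3) Q is a separator of Cᵒᵖ ⥤ Type u; (4) Hom(Q,−) is a monadic functor. -/
open CategoryTheory CategoryTheory.Limits

universe u

namespace CoyTfae

/-- The cocone on `K ⋙ G` induced by a cocone on `K ⋙ F`. -/
def retCocone {D E J : Type*} [Category D] [Category E] [Category J]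
    {F G : D ⥤ E} (r : G ⟶ F) (K : J ⥤ D) (s : Cocone (K ⋙ F)) : Cocone (K ⋙ G) :=
  ⟨s.pt, { app := fun j => r.app (K.obj j) ≫ s.ι.app j
           naturality := by
            intro a b f
            have := s.w f
            simp only [Functor.comp_map] at this
            simp [this] }⟩

lemma preserves_of_retract {D E J : Type*} [Category D] [Category E] [Category J]
    {F G : D ⥤ E} (i : F ⟶ G) (r : G ⟶ F) (h : i ≫ r = 𝟙 F) (K : J ⥤ D)
    [PreservesColimit K G] : PreservesColimit K F where
  preserves {c} hc := by
    have hG := isColimitOfPreserves G hc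
    have h1 := fun X => congr_app h X
    simp only [NatTrans.comp_app, NatTrans.id_app] at h1
    refine ⟨{
      desc := fun s => i.app c.pt ≫ hG.desc (retCocone r K s)
      fac := ?_
      uniq := ?_ }⟩
    · intro s j
      have h2 := hG.fac (retCocone r K s) j
      dsimp [retCocone] at h2 ⊢
      rw [i.naturality_assoc, h2, reassoc_of% (h1 (K.obj j))]
    · intro s m hm
      have h2 : r.app c.pt ≫ m = hG.desc (retCocone r K s) := by
        apply hG.hom_ext
        intro j
        refine Eq.trans ?_ (hG.fac (retCocone r K s) j).symm
        have := hm j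
        dsimp [retCocone] at this ⊢
        rw [r.naturality_assoc, this]
      rw [← h2, reassoc_of% (h1 c.pt)]

variable {C : Type u} [SmallCategory C]

/-- The canonical coproduct of representables covering `Q`. -/
def cover (Q : Cᵒᵖ ⥤ Type u) : Cᵒᵖ ⥤ Type u where
  obj c := Σ i : (Σ d : C, Q.obj (Opposite.op d)), (c.unop ⟶ i.1)
  map f := ↾fun x => ⟨x.1, f.unop ≫ x.2⟩

/-- The covering map. -/
def coverMap (Q : Cᵒᵖ ⥤ Type u) : cover Q ⟶ Q where
  app c := ↾fun x => Q.map x.2.op x.1.2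
  naturality := by
    intro a b f
    ext x
    change Q.map (f.unop ≫ x.2).op x.1.2 = Q.map f (Q.map x.2.op x.1.2)
    simp

instance (Q : Cᵒᵖ ⥤ Type u) : Epi (coverMap Q) := by
  have : ∀ c, Epi ((coverMap Q).app c) := by
    intro c
    rw [epi_iff_surjective]
    intro x
    refine ⟨⟨⟨c.unop, x⟩, 𝟙 _⟩, ?_⟩
    simp [coverMap]
  exact NatTrans.epi_of_epi_app _

/-- Complementary subfunctors give a coproduct decomposition. -/
noncomputable def cofanIsColimit {Q : Cᵒᵖ ⥤ Type u} (A B : Subfunctor Q)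
    (h : ∀ c (x : Q.obj c), x ∈ B.obj c ↔ x ∉ A.obj c) :
    IsColimit (BinaryCofan.mk A.ι B.ι) := by
  classical
  refine BinaryCofan.isColimitMk
    (fun s => { app := fun c => ↾fun x => if hx : x ∈ A.obj c then s.inl.app c ⟨x, hx⟩
                  else s.inr.app c ⟨x, (h c x).2 hx⟩
                naturality := ?_ }) ?_ ?_ ?_
  · intro a b f
    ext x
    by_cases hx : x ∈ A.obj a
    · have hx' := A.map f hx
      have := ConcreteCategory.congr_hom (s.inl.naturality f) ⟨x, hx⟩
      have hx'' : Q.map f x ∈ A.obj b := hx'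
      simp [hx, hx'']
      exact this
    · have hx' := B.map f ((h _ _).2 hx)
      have := ConcreteCategory.congr_hom (s.inr.naturality f) ⟨x, (h _ _).2 hx⟩
      have hx'' : Q.map f x ∉ A.obj b := (h _ _).1 hx'
      simp [hx, hx'']
      exact this
  · intro s
    ext c x
    exact dif_pos x.2
  · intro s
    ext c x
    exact dif_neg ((h _ _).1 x.2)
  · intro s m h1 h2
    ext c x
    by_cases hx : x ∈ A.obj c
    · have := ConcreteCategory.congr_hom (congr_app h1 c) ⟨x, hx⟩
      simp [hx]
      exact this
    · have := ConcreteCategory.congr_hom (congr_app h2 c) ⟨x, (h _ _).2 hx⟩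
      simp [hx]
      exact this

lemma exists_elem {Q : Cᵒᵖ ⥤ Type u} (hQ : IsInitial Q → False) :
    ∃ c, Nonempty (Q.obj c) := by
  by_contra hne
  push Not at hne
  apply hQ
  refine IsInitial.ofUniqueHom
    (fun Y => { app := fun c => ↾fun x => (hne c).elim x
                naturality := fun a b f => by ext x; exact (hne a).elim x }) ?_
  intro Y m
  ext c x
  exact (hne c).elim x

lemma all_or {Q : Cᵒᵖ ⥤ Type u} (hQ : Indecomposable Q) (A B : Subfunctor Q)
    (h : ∀ c (x : Q.obj c), x ∈ B.obj c ↔ x ∉ A.obj c) :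
    (∀ c x, x ∈ A.obj c) ∨ (∀ c x, x ∈ B.obj c) := by
  let e := (cofanIsColimit A B h).coconePointUniqueUpToIso
    (coprodIsCoprod A.toFunctor B.toFunctor)
  have he : IsIso e.hom := e.isIso_hom
  have key : ∀ S : Subfunctor Q, IsIso S.ι → ∀ c x, x ∈ S.obj c := by
    intro S hS c x
    have : IsIso (S.ι.app c) := inferInstance
    obtain ⟨y, hy⟩ := ((isIso_iff_bijective _).1 this).2 x
    rw [← hy]
    exact y.2
  have hl : A.ι ≫ e.hom = coprod.inl :=
    (cofanIsColimit A B h).comp_coconePointUniqueUpToIso_hom _ ⟨WalkingPair.left⟩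
  have hr : B.ι ≫ e.hom = coprod.inr :=
    (cofanIsColimit A B h).comp_coconePointUniqueUpToIso_hom _ ⟨WalkingPair.right⟩
  rcases hQ.2 _ _ ⟨e⟩ with h1 | h1
  · left
    apply key
    rw [← hl] at h1
    exact @IsIso.of_isIso_comp_right _ _ _ _ _ A.ι e.hom he h1
  · right
    apply key
    rw [← hr] at h1
    exact @IsIso.of_isIso_comp_right _ _ _ _ _ B.ι e.hom he h1

lemma exists_retract {Q : Cᵒᵖ ⥤ Type u} (hQ : Indecomposable Q) (hproj : Projective Q) :
    ∃ (d : C) (i : Q ⟶ yoneda.obj d) (r : yoneda.obj d ⟶ Q), i ≫ r = 𝟙 Q := by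
  obtain ⟨c₀, ⟨q₀⟩⟩ := exists_elem hQ.1
  let s : Q ⟶ cover Q := Projective.factorThru (𝟙 Q) (coverMap Q)
  have hs : s ≫ coverMap Q = 𝟙 Q := Projective.factorThru_comp _ _
  have hsx : ∀ c (x : Q.obj c), (coverMap Q).app c (s.app c x) = x := fun c x =>
    ConcreteCategory.congr_hom (congr_app hs c) x
  have nat : ∀ {a b} (f : a ⟶ b) (x : Q.obj a),
      s.app b (Q.map f x) = (cover Q).map f (s.app a x) := fun f x =>
    ConcreteCategory.congr_hom (s.naturality f) x
  have fst : ∀ {a b} (f : a ⟶ b) (x : Q.obj a), (s.app b (Q.map f x)).1 = (s.app a x).1 := by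
    intro a b f x
    rw [nat]; rfl
  let t := (s.app c₀ q₀).1
  let A : Subfunctor Q :=
    { obj := fun c => {x | (s.app c x).1 = t}
      map := fun f x hx => (fst f x).trans hx }
  let B : Subfunctor Q :=
    { obj := fun c => {x | (s.app c x).1 ≠ t}
      map := fun f x hx hx' => hx ((fst f x).symm.trans hx') }
  have hA : ∀ c (x : Q.obj c), (s.app c x).1 = t := by
    rcases all_or hQ A B (fun c x => Iff.rfl) with h | h
    · exact h
    · exact (h c₀ q₀ rfl).elim
  have hf : ∀ c (x : Q.obj c), ∃ f : c.unop ⟶ t.1, s.app c x = ⟨t, f⟩ := by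
    intro c x
    have := hA c x
    rcases hh : s.app c x with ⟨j, g⟩
    rw [hh] at this
    dsimp at this
    subst this
    exact ⟨g, rfl⟩
  choose g hg using hf
  refine ⟨t.1, { app := fun c => ↾fun x => g c x, naturality := ?_ },
    yonedaEquiv.symm t.2, ?_⟩
  · intro a b f
    ext x
    have h1 := nat f x
    rw [hg, hg] at h1
    exact eq_of_heq (Sigma.mk.inj h1).2
  · ext c x
    have := hsx c x
    rw [hg] at this
    exact this

lemma preserves {Q : Cᵒᵖ ⥤ Type u} (hQ : Indecomposable Q) (hproj : Projective Q)
    {J : Type*} [Category J] (K : J ⥤ Cᵒᵖ ⥤ Type u) [HasColimitsOfShape J (Type u)] :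
    PreservesColimit K (coyoneda.obj (Opposite.op Q)) := by
  obtain ⟨d, i, r, h⟩ := exists_retract hQ hproj
  have : PreservesColimit K (coyoneda.obj (Opposite.op (yoneda.obj d))) :=
    preservesColimit_of_natIso K (F := (evaluation Cᵒᵖ (Type u)).obj (Opposite.op d))
      (NatIso.ofComponents (fun F => (yonedaEquiv (X := d) (F := F)).symm.toIso) (by
        intro F G f
        ext x
        apply yonedaEquiv.injective
        simp [yonedaEquiv_comp]))
  refine preserves_of_retract (coyoneda.map r.op) (coyoneda.map i.op) ?_ K
  rw [← Functor.map_comp, ← op_comp, h]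
  simp

end CoyTfae

/-- For an indecomposable projective presheaf `Q` on a small category `C`, the following
are equivalent: `Hom(Q, -)` is faithful; `Hom(Q, -)` is conservative (reflects
isomorphisms); `Q` is a separator; `Hom(Q, -)` is monadic. -/
theorem coyoneda_faithful_tfae (C : Type u) [SmallCategory C] (Q : Cᵒᵖ ⥤ Type u)
    (hQ : Indecomposable Q) (hproj : Projective Q) :
    List.TFAE
      [(coyoneda.obj (Opposite.op Q)).Faithful,
       (coyoneda.obj (Opposite.op Q)).ReflectsIsomorphisms,
       IsSeparator Q,
       Nonempty (MonadicRightAdjoint (coyoneda.obj (Opposite.op Q)))] := by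
  tfae_have 1 ↔ 3 := (isSeparator_iff_faithful_coyoneda_obj Q).symm
  tfae_have 1 → 2 := fun _ => inferInstance
  tfae_have 2 → 3 := fun h =>
    ((isDetector_iff_reflectsIsomorphisms_coyoneda_obj Q).2 h).isSeparator
  tfae_have 2 → 4 := fun h => by
    have : Monad.PreservesColimitOfIsReflexivePair (coyoneda.obj (Opposite.op Q)) :=
      ⟨fun _ _ _ _ _ => CoyTfae.preserves hQ hproj _⟩
    exact ⟨Monad.monadicOfHasPreservesReflexiveCoequalizersOfReflectsIsomorphisms
      (sigmaConstAdj Q)⟩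
  tfae_have 4 → 2 := fun ⟨h⟩ => by
    have := h
    have e : Monad.comparison (monadicAdjunction (coyoneda.obj (Opposite.op Q))) ⋙
      Monad.forget _ = coyoneda.obj (Opposite.op Q) := rfl
    rw [← e]
    infer_instance
  tfae_finish
end

section
/- Let C be a small category. (i) If Q and Q' are both indecomposable projective separators of the presheaf category Cᵒᵖ ⥤ Type u, then Q is a retract of Q' and Q' is a retract of Q. (ii) Conversely, if Q is an indecomposable projective separator, and Q and Q' are retracts of one another, then Q' is also an indecomposable projective separator. -/
open CategoryTheory CategoryTheory.Limits

universe u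

/-- The constant presheaf. -/
abbrev cst (C : Type u) [SmallCategory C] (S : Type u) : Cᵒᵖ ⥤ Type u :=
  (Functor.const Cᵒᵖ).obj S

/-- Subpresheaf of elements whose label satisfies `P`. -/
def sub {C : Type u} [SmallCategory C] {Q : Cᵒᵖ ⥤ Type u} {S : Type u} (χ : Q ⟶ cst C S)
    (P : S → Prop) : Cᵒᵖ ⥤ Type u where
  obj c := {x : Q.obj c // P (χ.app c x)}
  map f := ↾fun x => ⟨Q.map f x.1, by
    have := NatTrans.naturality_apply χ f x.1
    rw [this]; exact x.2⟩
  map_id c := by ext x; simp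
  map_comp f g := by ext x; simp

/-- inclusion -/
def subι {C : Type u} [SmallCategory C] {Q : Cᵒᵖ ⥤ Type u} {S : Type u} (χ : Q ⟶ cst C S)
    (P : S → Prop) : sub χ P ⟶ Q where
  app c := ↾fun x => x.1
  naturality _ _ f := by ext x; rfl

open Classical in
/-- splitting map -/
noncomputable def splitMap {C : Type u} [SmallCategory C] {Q : Cᵒᵖ ⥤ Type u} {S : Type u}
    (χ : Q ⟶ cst C S) (P : S → Prop) : Q ⟶ sub χ P ⨿ sub χ (fun s => ¬ P s) where
  app c := ↾fun x => if h : P (χ.app c x) then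
      (coprod.inl : sub χ P ⟶ sub χ P ⨿ sub χ (fun s => ¬ P s)).app c ⟨x, h⟩
    else (coprod.inr : _ ⟶ sub χ P ⨿ sub χ (fun s => ¬ P s)).app c ⟨x, h⟩
  naturality c d f := by
    ext x
    have hn : χ.app d (Q.map f x) = χ.app c x := NatTrans.naturality_apply χ f x
    by_cases h : P (χ.app c x)
    · have h' : P (χ.app d (Q.map f x)) := by rw [hn]; exact h
      exact (dif_pos h').trans ((NatTrans.naturality_apply
        (coprod.inl : sub χ P ⟶ sub χ P ⨿ sub χ (fun s => ¬ P s)) f ⟨x, h⟩).trans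
        (congrArg ((sub χ P ⨿ sub χ (fun s => ¬ P s)).map f) (Eq.symm (by exact dif_pos h))))
    · have h' : ¬ P (χ.app d (Q.map f x)) := by rw [hn]; exact h
      exact (dif_neg h').trans ((NatTrans.naturality_apply
        (coprod.inr : _ ⟶ sub χ P ⨿ sub χ (fun s => ¬ P s)) f ⟨x, h⟩).trans
        (congrArg ((sub χ P ⨿ sub χ (fun s => ¬ P s)).map f) (Eq.symm (by exact dif_neg h))))

/-- joining map -/
noncomputable def joinMap {C : Type u} [SmallCategory C] {Q : Cᵒᵖ ⥤ Type u} {S : Type u}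
    (χ : Q ⟶ cst C S) (P : S → Prop) : sub χ P ⨿ sub χ (fun s => ¬ P s) ⟶ Q :=
  coprod.desc (subι χ P) (subι χ _)

lemma split_join {C : Type u} [SmallCategory C] {Q : Cᵒᵖ ⥤ Type u} {S : Type u}
    (χ : Q ⟶ cst C S) (P : S → Prop) : splitMap χ P ≫ joinMap χ P = 𝟙 Q := by
  ext c x
  have h1 : (coprod.inl : sub χ P ⟶ sub χ P ⨿ sub χ (fun s => ¬ P s)) ≫ joinMap χ P
    = subι χ P := coprod.inl_desc _ _
  have h2 : (coprod.inr : _ ⟶ sub χ P ⨿ sub χ (fun s => ¬ P s)) ≫ joinMap χ P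
    = subι χ _ := coprod.inr_desc _ _
  by_cases h : P (χ.app c x)
  · have := ConcreteCategory.congr_hom (NatTrans.congr_app h1 c) ⟨x, h⟩
    exact (congrArg ((joinMap χ P).app c) (dif_pos h)).trans this
  · have := ConcreteCategory.congr_hom (NatTrans.congr_app h2 c) ⟨x, h⟩
    exact (congrArg ((joinMap χ P).app c) (dif_neg h)).trans this

lemma join_split {C : Type u} [SmallCategory C] {Q : Cᵒᵖ ⥤ Type u} {S : Type u}
    (χ : Q ⟶ cst C S) (P : S → Prop) : joinMap χ P ≫ splitMap χ P = 𝟙 _ := by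
  apply coprod.hom_ext
  · rw [joinMap, coprod.inl_desc_assoc, Category.comp_id]
    ext c x
    exact dif_pos x.2
  · rw [joinMap, coprod.inr_desc_assoc, Category.comp_id]
    ext c x
    exact dif_neg x.2

lemma indec_dichotomy {C : Type u} [SmallCategory C] {Q : Cᵒᵖ ⥤ Type u} (hQ : Indecomposable Q)
    {S : Type u} (χ : Q ⟶ cst C S) (P : S → Prop) :
    (∀ c (x : Q.obj c), P (χ.app c x)) ∨ (∀ c (x : Q.obj c), ¬ P (χ.app c x)) := by
  rcases hQ.2 _ _ ⟨⟨splitMap χ P, joinMap χ P, split_join χ P, join_split χ P⟩⟩ with h | h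
  · left
    intro c x
    have : (splitMap χ P ≫ inv coprod.inl) ≫ subι χ P = 𝟙 Q := by
      rw [← split_join χ P, Category.assoc]; congr 1
      rw [IsIso.inv_comp_eq, joinMap, coprod.inl_desc]
    have := ConcreteCategory.congr_hom (NatTrans.congr_app this c) x
    have h2 := ((splitMap χ P ≫ inv coprod.inl).app c x).2
    have h3 : ((splitMap χ P ≫ inv coprod.inl).app c x).1 = x := this
    rwa [h3] at h2
  · right
    intro c x
    have : (splitMap χ P ≫ inv coprod.inr) ≫ subι χ _ = 𝟙 Q := by
      rw [← split_join χ P, Category.assoc]; congr 1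
      rw [IsIso.inv_comp_eq, joinMap, coprod.inr_desc]
    have := ConcreteCategory.congr_hom (NatTrans.congr_app this c) x
    have h2 := ((splitMap χ P ≫ inv coprod.inr).app c x).2
    have h3 : ((splitMap χ P ≫ inv coprod.inr).app c x).1 = x := this
    rwa [h3] at h2

/-- An empty presheaf is initial. -/
noncomputable def emptyInitial {C : Type u} [SmallCategory C] {Q : Cᵒᵖ ⥤ Type u}
    (h : ∀ c, Q.obj c → False) : IsInitial Q :=
  IsInitial.ofUniqueHom
    (fun Y => { app := fun c => ↾fun x => (h c x).elim
                naturality := fun c d f => by ext x; exact (h c x).elim })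
    (fun Y m => by ext c x; exact (h c x).elim)

lemma exists_retract {C : Type u} [SmallCategory C] {Q Q' : Cᵒᵖ ⥤ Type u}
    (hQ : Indecomposable Q) (hP : Projective Q) (hS : IsSeparator Q') :
    ∃ (i : Q ⟶ Q') (r : Q' ⟶ Q), i ≫ r = 𝟙 Q := by
  have hne : ∃ c, Nonempty (Q.obj c) := by
    by_contra hc
    exact hQ.1 (emptyInitial fun c x => hc ⟨c, ⟨x⟩⟩)
  obtain ⟨c₀, ⟨q₀⟩⟩ := hne
  have he := (isSeparator_iff_epi Q').1 hS Q
  let s : Q ⟶ ∐ (fun _ : Q' ⟶ Q => Q') :=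
    Projective.factorThru (𝟙 Q) (Sigma.desc fun f : Q' ⟶ Q => f)
  have hs : s ≫ Sigma.desc (fun f : Q' ⟶ Q => f) = 𝟙 Q := Projective.factorThru_comp _ _
  let lab : ∐ (fun _ : Q' ⟶ Q => Q') ⟶ cst C (Q' ⟶ Q) :=
    Sigma.desc fun f => { app := fun c => ↾fun _ => f
                          naturality := fun _ _ _ => by ext; rfl }
  let f₀ : Q' ⟶ Q := (s ≫ lab).app c₀ q₀
  have hconst : ∀ c (x : Q.obj c), (s ≫ lab).app c x = f₀ := by
    rcases indec_dichotomy hQ (s ≫ lab) (fun f => f = f₀) with h | h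
    · exact h
    · exact (h c₀ q₀ rfl).elim
  let fold : ∐ (fun _ : Q' ⟶ Q => Q') ⟶ Q' := Sigma.desc fun _ => 𝟙 Q'
  have key : ∀ c (z : (∐ (fun _ : Q' ⟶ Q => Q')).obj c), lab.app c z = f₀ →
      f₀.app c (fold.app c z) = (Sigma.desc (fun f : Q' ⟶ Q => f)).app c z := by
    intro c z hz
    obtain ⟨⟨g⟩, y, hy⟩ := Types.jointly_surjective_of_isColimit
      (isColimitOfPreserves ((evaluation Cᵒᵖ (Type u)).obj c)
        (colimit.isColimit (Discrete.functor (fun _ : Q' ⟶ Q => Q')))) z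
    have hy' : (Sigma.ι (fun _ : Q' ⟶ Q => Q') g).app c y = z := hy
    subst hy'
    have e1 : (Sigma.ι (fun _ : Q' ⟶ Q => Q') g) ≫ lab = _ := Sigma.ι_desc _ _
    have e2 : (Sigma.ι (fun _ : Q' ⟶ Q => Q') g) ≫ fold = _ := Sigma.ι_desc _ _
    have e3 : (Sigma.ι (fun _ : Q' ⟶ Q => Q') g) ≫ Sigma.desc (fun f : Q' ⟶ Q => f) = _ :=
      Sigma.ι_desc _ _
    have e1' : lab.app c ((Sigma.ι (fun _ : Q' ⟶ Q => Q') g).app c y) = g :=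
      ConcreteCategory.congr_hom (NatTrans.congr_app e1 c) y
    have e2' : fold.app c ((Sigma.ι (fun _ : Q' ⟶ Q => Q') g).app c y) = y :=
      ConcreteCategory.congr_hom (NatTrans.congr_app e2 c) y
    have e3' : (Sigma.desc (fun f : Q' ⟶ Q => f)).app c
        ((Sigma.ι (fun _ : Q' ⟶ Q => Q') g).app c y) = g.app c y :=
      ConcreteCategory.congr_hom (NatTrans.congr_app e3 c) y
    rw [e2', e3', ← hz, e1']
  refine ⟨s ≫ fold, f₀, ?_⟩
  rw [← hs]
  ext c x
  exact key c (s.app c x) (hconst c x)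

lemma indec_of_retract {C : Type u} [SmallCategory C] {Q Q' : Cᵒᵖ ⥤ Type u}
    (hQ : Indecomposable Q) (h1 : ∃ (i : Q ⟶ Q') (r : Q' ⟶ Q), i ≫ r = 𝟙 Q)
    (h2 : ∃ (i : Q' ⟶ Q) (r : Q ⟶ Q'), i ≫ r = 𝟙 Q') : Indecomposable Q' := by
  obtain ⟨i, r, hir⟩ := h1
  obtain ⟨j, p, hjp⟩ := h2
  refine ⟨fun hI => hQ.1 (hI.ofIso ⟨r, i, hI.hom_ext _ _, hir⟩), ?_⟩
  rintro A B ⟨e⟩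
  let mk (b : ULift.{u} Bool) (X : Cᵒᵖ ⥤ Type u) : X ⟶ cst C (ULift.{u} Bool) :=
    { app := fun c => ↾fun _ => b
      naturality := fun _ _ _ => by ext; rfl }
  let lab : A ⨿ B ⟶ cst C (ULift.{u} Bool) := coprod.desc (mk ⟨true⟩ A) (mk ⟨false⟩ B)
  have el : coprod.inl ≫ lab = mk ⟨true⟩ A := coprod.inl_desc _ _
  have er : coprod.inr ≫ lab = mk ⟨false⟩ B := coprod.inr_desc _ _
  have hlift : (e.inv ≫ j) ≫ (p ≫ e.hom ≫ lab) = lab := by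
    simp [reassoc_of% hjp]
  have hl : ∀ c z, (p ≫ e.hom ≫ lab).app c ((e.inv ≫ j).app c z) = lab.app c z :=
    fun c z => ConcreteCategory.congr_hom (NatTrans.congr_app hlift c) z
  have hl1 : ∀ c (a : A.obj c),
      lab.app c ((coprod.inl : A ⟶ A ⨿ B).app c a) = ⟨true⟩ :=
    fun c a => ConcreteCategory.congr_hom (NatTrans.congr_app el c) a
  have hl2 : ∀ c (b : B.obj c),
      lab.app c ((coprod.inr : B ⟶ A ⨿ B).app c b) = ⟨false⟩ :=
    fun c b => ConcreteCategory.congr_hom (NatTrans.congr_app er c) b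
  rcases indec_dichotomy hQ (p ≫ e.hom ≫ lab) (fun b => b = ⟨true⟩) with h | h
  · left
    have hB : IsInitial B := emptyInitial fun c b => by
      have := h c ((e.inv ≫ j).app c ((coprod.inr : B ⟶ A ⨿ B).app c b))
      rw [hl, hl2] at this
      simp at this
    refine ⟨coprod.desc (𝟙 A) (hB.to A), coprod.inl_desc _ _, ?_⟩
    apply coprod.hom_ext
    · rw [coprod.inl_desc_assoc, Category.id_comp, Category.comp_id]
    · exact hB.hom_ext _ _
  · right
    have hA : IsInitial A := emptyInitial fun c a => by
      have := h c ((e.inv ≫ j).app c ((coprod.inl : A ⟶ A ⨿ B).app c a))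
      rw [hl, hl1] at this
      simp at this
    refine ⟨coprod.desc (hA.to B) (𝟙 B), coprod.inr_desc _ _, ?_⟩
    apply coprod.hom_ext
    · exact hA.hom_ext _ _
    · rw [coprod.inr_desc_assoc, Category.id_comp, Category.comp_id]

/-- (i) Any two indecomposable projective separators of a presheaf category are retracts
of one another. (ii) Conversely, if `Q` is an indecomposable projective separator and `Q`
and `Q'` are retracts of one another, then `Q'` is also an indecomposable projective
separator. -/
theorem indecomposable_projective_separators_retracts (C : Type u) [SmallCategory C] :
    (∀ Q Q' : Cᵒᵖ ⥤ Type u,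
      Indecomposable Q → Projective Q → IsSeparator Q →
      Indecomposable Q' → Projective Q' → IsSeparator Q' →
      (∃ (i : Q ⟶ Q') (r : Q' ⟶ Q), i ≫ r = 𝟙 Q) ∧
      (∃ (i : Q' ⟶ Q) (r : Q ⟶ Q'), i ≫ r = 𝟙 Q')) ∧
    (∀ Q Q' : Cᵒᵖ ⥤ Type u,
      Indecomposable Q → Projective Q → IsSeparator Q →
      (∃ (i : Q ⟶ Q') (r : Q' ⟶ Q), i ≫ r = 𝟙 Q) →
      (∃ (i : Q' ⟶ Q) (r : Q ⟶ Q'), i ≫ r = 𝟙 Q') →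
      (Indecomposable Q' ∧ Projective Q' ∧ IsSeparator Q')) := by
  refine ⟨fun Q Q' h1 h2 h3 h4 h5 h6 => ⟨exists_retract h1 h2 h6, exists_retract h4 h5 h3⟩, ?_⟩
  intro Q Q' h1 h2 h3 h4 h5
  refine ⟨indec_of_retract h1 h4 h5, ?_, ?_⟩
  · obtain ⟨i, r, h⟩ := h5
    exact Retract.projective (Y := Q) ⟨i, r, h⟩
  · obtain ⟨i, r, h⟩ := h4
    rw [isSeparator_def] at h3 ⊢
    intro X Y f g hfg
    apply h3
    intro k
    have := hfg (r ≫ k)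
    rw [← Category.id_comp k, ← h]
    simp only [Category.assoc] at this ⊢
    rw [this]
end

section
/- Let C be a small category and suppose Q is an indecomposable projective separator of the presheaf category Cᵒᵖ ⥤ Type u. Then Cᵒᵖ ⥤ Type u is equivalent to the category of right M-sets PSh(M), where M is the endomorphism monoid of Q with multiplication f * g = f ∘ g (i.e. the right action of m ∈ M on x ∈ Hom(Q, X) is x · m = x ∘ m). -/
open CategoryTheory CategoryTheory.Limits

universe u w

lemma aux_hit {C : Type u} [SmallCategory C] {Q : Cᵒᵖ ⥤ Type u} (hsep : IsSeparator Q)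
    (X : Cᵒᵖ ⥤ Type u) (d : Cᵒᵖ) (x : X.obj d) : ∃ (f : Q ⟶ X) (q : Q.obj d), f.app d q = x := by
  let S : Subfunctor X := ⨆ f : Q ⟶ X, Subfunctor.range f
  have hS : ∀ (f : Q ⟶ X), Subfunctor.range f ≤ S := fun f => le_iSup (fun f : Q ⟶ X => Subfunctor.range f) f
  have : IsIso S.ι := by
    refine (isDetector_def Q).1 hsep.isDetector S.ι ?_
    intro h
    refine ⟨Subfunctor.lift h (hS h), by simp, ?_⟩
    intro y hy
    rw [← cancel_mono S.ι, hy]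
    simp
  have hx : x ∈ S.obj d := by
    have hb : Function.Surjective (S.ι.app d) := by
      rw [← epi_iff_surjective]; infer_instance
    obtain ⟨y, rfl⟩ := hb x
    exact y.2
  simp only [S, Subfunctor.iSup_obj, Set.mem_iUnion] at hx
  obtain ⟨f, q, hq⟩ := hx
  exact ⟨f, q, hq⟩

lemma aux_retract_rep {C : Type u} [SmallCategory C] {Q : Cᵒᵖ ⥤ Type u} (hsep : IsSeparator Q)
    (c : C) : Nonempty (Retract (yoneda.obj c) Q) := by
  obtain ⟨f, q, hq⟩ := aux_hit hsep (yoneda.obj c) (Opposite.op c) (𝟙 c)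
  refine ⟨⟨yonedaEquiv.symm q, f, ?_⟩⟩
  apply yonedaEquiv.injective
  rw [yonedaEquiv_comp]
  rw [yonedaEquiv_apply, yonedaEquiv_apply]
  simp [hq]

/-- The canonical coproduct of representables covering a presheaf. -/
def auxCover {C : Type u} [SmallCategory C] (Q : Cᵒᵖ ⥤ Type u) : Cᵒᵖ ⥤ Type u where
  obj d := Σ e : (Σ c : C, Q.obj (Opposite.op c)), (d.unop ⟶ e.1)
  map g := ↾fun t => ⟨t.1, g.unop ≫ t.2⟩

/-- The canonical map from the cover. -/
def auxCoverMap {C : Type u} [SmallCategory C] (Q : Cᵒᵖ ⥤ Type u) : auxCover Q ⟶ Q where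
  app d := ↾fun t => Q.map t.2.op t.1.2
  naturality _ _ g := by
    ext t
    change Q.map (g.unop ≫ t.2).op t.1.2 = Q.map g (Q.map t.2.op t.1.2)
    simp

lemma aux_retract_s12 {C : Type u} [SmallCategory C] {Q : Cᵒᵖ ⥤ Type u}
    (hQ : Indecomposable Q) (hproj : Projective Q) :
    ∃ c : C, Nonempty (Retract Q (yoneda.obj c)) := by
  classical
  obtain ⟨d₀, q₀, -⟩ : ∃ (d : Cᵒᵖ) (q : Q.obj d), True := by
    by_contra! h
    refine hQ.1 (IsInitial.ofUniqueHom (fun Y => ⟨fun d => ↾fun q => (h d q).elim, ?_⟩) ?_)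
    · intro d _ _
      ext q
      exact (h d q).elim
    · intro Y m
      ext d q
      exact (h d q).elim
  have hepi : Epi (auxCoverMap Q) := by
    rw [NatTrans.epi_iff_epi_app]
    intro d
    rw [epi_iff_surjective]
    intro q
    exact ⟨⟨⟨d.unop, q⟩, 𝟙 _⟩, by simp [auxCoverMap]⟩
  let s : Q ⟶ auxCover Q := Projective.factorThru (𝟙 Q) (auxCoverMap Q)
  have hs : s ≫ auxCoverMap Q = 𝟙 Q := Projective.factorThru_comp _ _
  have hs1 : ∀ {d d' : Cᵒᵖ} (g : d ⟶ d') (q : Q.obj d),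
      s.app d' (Q.map g q) = (⟨(s.app d q).1, g.unop ≫ (s.app d q).2⟩ : (auxCover Q).obj d') :=
    fun g q => NatTrans.naturality_apply s g q
  let e₀ := (s.app d₀ q₀).1
  let A : Subfunctor Q := ⟨fun d => {q | (s.app d q).1 = e₀}, by
    intro d d' g q hq
    change (s.app d' (Q.map g q)).1 = e₀
    rw [hs1]; exact hq⟩
  let B : Subfunctor Q := ⟨fun d => {q | (s.app d q).1 ≠ e₀}, by
    intro d d' g q hq
    change (s.app d' (Q.map g q)).1 ≠ e₀
    rw [hs1]; exact hq⟩
  let F := FunctorToTypes.coprod.desc A.ι B.ι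
  have hF : IsIso F := by
    rw [NatTrans.isIso_iff_isIso_app]
    intro d
    rw [isIso_iff_bijective]
    constructor
    · rintro (⟨x, hx⟩ | ⟨x, hx⟩) (⟨y, hy⟩ | ⟨y, hy⟩) (h : x = y)
      · subst h; rfl
      · subst h; exact (hy hx).elim
      · subst h; exact (hx hy).elim
      · subst h; rfl
    · intro q
      by_cases hq : (s.app d q).1 = e₀
      · exact ⟨Sum.inl ⟨q, hq⟩, rfl⟩
      · exact ⟨Sum.inr ⟨q, hq⟩, rfl⟩
  have key : ∀ d (q : Q.obj d), (s.app d q).1 = e₀ := by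
    rcases hQ.2 A.toFunctor B.toFunctor
      ⟨(asIso F).symm ≪≫ (FunctorToTypes.binaryCoproductIso _ _).symm⟩ with h | h
    · intro d q
      by_contra hq
      have h2 : IsIso (FunctorToTypes.coprod.inl : A.toFunctor ⟶ FunctorToTypes.coprod A.toFunctor B.toFunctor) := by
        rw [← FunctorToTypes.inl_comp_binaryCoproductIso_hom]; infer_instance
      have h3 := (isIso_iff_bijective _).1 ((NatTrans.isIso_iff_isIso_app _).1 h2 d)
      obtain ⟨y, hy⟩ := h3.2 (Sum.inr ⟨q, hq⟩)
      exact Sum.inl_ne_inr hy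
    · exfalso
      have h2 : IsIso (FunctorToTypes.coprod.inr : B.toFunctor ⟶ FunctorToTypes.coprod A.toFunctor B.toFunctor) := by
        rw [← FunctorToTypes.inr_comp_binaryCoproductIso_hom]; infer_instance
      have h3 := (isIso_iff_bijective _).1 ((NatTrans.isIso_iff_isIso_app _).1 h2 d₀)
      obtain ⟨y, hy⟩ := h3.2 (Sum.inl ⟨q₀, rfl⟩)
      exact Sum.inr_ne_inl hy
  have key2 : ∀ d (q : Q.obj d), ∃ f : d.unop ⟶ e₀.1,
      s.app d q = (⟨e₀, f⟩ : (auxCover Q).obj d) := by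
    intro d q
    have := key d q
    generalize s.app d q = t at this
    obtain ⟨e, f⟩ := t
    dsimp at this
    subst this
    exact ⟨f, rfl⟩
  choose φ hφ using key2
  refine ⟨e₀.1, ⟨⟨⟨fun d => ↾fun q => φ d q, ?_⟩, yonedaEquiv.symm e₀.2, ?_⟩⟩⟩
  · intro d d' g
    ext q
    have h1 := hs1 g q
    rw [hφ, hφ] at h1
    exact eq_of_heq (Sigma.mk.inj h1).2
  · ext d q
    have h1 := ConcreteCategory.congr_hom (congr_app hs d) q
    change (auxCoverMap Q).app d (s.app d q) = q at h1
    rw [hφ] at h1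
    exact h1

lemma aux_equiv {A : Type w} [Category.{u} A] {E : Type (u+1)} [Category.{u} E] (G : A ⥤ E)
    [G.Full] [G.Faithful] [∀ X : Eᵒᵖ, HasLimitsOfShape (StructuredArrow X G.op) (Type u)]
    (h : ∀ X : E, ∃ a : A, Nonempty (Retract X (G.obj a))) :
    Nonempty ((Aᵒᵖ ⥤ Type u) ≌ (Eᵒᵖ ⥤ Type u)) := by
  have h1 : G.IsCoverDense ⊥ := ⟨fun X => by
    obtain ⟨a, ⟨r⟩⟩ := h X
    rw [GrothendieckTopology.bot_covering, ← Sieve.id_mem_iff_eq_top]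
    exact ⟨⟨a, r.i, r.r, r.retract⟩⟩⟩
  have h2 : G.IsDenseSubsite ⊥ ⊥ :=
    { functorPushforward_mem_iff := by
        intro X S
        rw [GrothendieckTopology.bot_covering, GrothendieckTopology.bot_covering,
          ← Sieve.id_mem_iff_eq_top, ← Sieve.id_mem_iff_eq_top]
        constructor
        · rintro ⟨Z, g, k, hg, hk⟩
          have : 𝟙 X = G.preimage k ≫ g := G.map_injective (by simpa using hk)
          rw [this]
          exact S.downward_closed hg _
        · intro hS
          exact ⟨X, 𝟙 X, 𝟙 _, hS, by simp⟩ }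
  exact ⟨(sheafBotEquivalence _).symm.trans
    ((Functor.IsDenseSubsite.sheafEquiv ⊥ ⊥ G (Type u)).trans (sheafBotEquivalence _))⟩

/-- If the presheaf category on a small category `C` has an indecomposable projective
separator `Q`, then it is equivalent to the category of right `M`-sets, where `M` is the
endomorphism monoid of `Q` (with multiplication given by `f * g = f ∘ g`, i.e. the right
action of `m ∈ M` on `x ∈ Hom(Q, X)` is `x · m = x ∘ m`). -/
theorem presheaves_equiv_psh_end (C : Type u) [SmallCategory C] (Q : Cᵒᵖ ⥤ Type u)
    (hQ : Indecomposable Q) (hproj : Projective Q) (hsep : IsSeparator Q) :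
    Nonempty ((Cᵒᵖ ⥤ Type u) ≌ PSh (End Q)) := by
  let P : ObjectProperty (Cᵒᵖ ⥤ Type u) := fun X => Nonempty (Retract X Q)
  let G₁ : C ⥤ P.FullSubcategory := P.lift yoneda (fun c => aux_retract_rep hsep c)
  let Q' : P.FullSubcategory := ⟨Q, ⟨Retract.refl Q⟩⟩
  let G₂ : SingleObj (End Q) ⥤ P.FullSubcategory :=
    { obj _ := Q'
      map f := P.homMk f
      map_id _ := rfl
      map_comp _ _ := rfl }
  have : G₂.Full := ⟨fun f => ⟨f.hom, rfl⟩⟩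
  have : G₂.Faithful := ⟨fun h => congrArg (fun k => k.hom) h⟩
  have lft : ∀ {X Y : P.FullSubcategory}, Retract X.obj Y.obj → Nonempty (Retract X Y) :=
    fun r => ⟨⟨P.homMk r.i, P.homMk r.r, by ext1; exact r.retract⟩⟩
  obtain ⟨c, ⟨r⟩⟩ := aux_retract_s12 hQ hproj
  obtain ⟨e₁⟩ := aux_equiv (E := P.FullSubcategory) G₁ (fun X => ⟨c, lft (X.property.some.trans r)⟩)
  obtain ⟨e₂⟩ := aux_equiv (A := SingleObj (End Q)) (E := P.FullSubcategory) G₂ (fun X => ⟨SingleObj.star _, lft X.property.some⟩)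
  exact ⟨e₁.trans e₂.symm⟩
end

section
/- Let C be a small category. The presheaf category Cᵒᵖ ⥤ Type u is equivalent to the category of right M-sets for some monoid M (i.e. there exists a monoid M with Nonempty ((Cᵒᵖ ⥤ Type u) ≌ PSh(M))) if and only if Cᵒᵖ ⥤ Type u has an indecomposable projective separator. -/
open CategoryTheory CategoryTheory.Limits

universe u

open Opposite

universe w

/-- A fully faithful functor of which every target object is a retract of an image
induces an equivalence on presheaves. -/
theorem psh_equiv_of_retract {A : Type w} {B : Type u} [Category.{u} A] [SmallCategory B]
    (G : A ⥤ B) [G.Full] [G.Faithful] [∀ X, HasLimitsOfShape (StructuredArrow X G.op) (Type u)]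
    (h : ∀ b : B, ∃ (a : A) (i : b ⟶ G.obj a) (r : G.obj a ⟶ b), i ≫ r = 𝟙 b) :
    Nonempty ((Aᵒᵖ ⥤ Type u) ≌ (Bᵒᵖ ⥤ Type u)) := by
  have hc : G.IsCoverDense (⊥ : GrothendieckTopology B) := by
    constructor
    intro b
    obtain ⟨a, i, r, hir⟩ := h b
    rw [GrothendieckTopology.bot_covering, ← Sieve.id_mem_iff_eq_top]
    exact ⟨⟨a, i, r, hir⟩⟩
  have hd : G.IsDenseSubsite (⊥ : GrothendieckTopology A) (⊥ : GrothendieckTopology B) := by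
    refine { functorPushforward_mem_iff := ?_ }
    intro X S
    rw [GrothendieckTopology.bot_covering, GrothendieckTopology.bot_covering,
      ← Sieve.id_mem_iff_eq_top, ← Sieve.id_mem_iff_eq_top]
    constructor
    · rintro ⟨Z, g, k, hg, hk⟩
      have : G.preimage k ≫ g = 𝟙 X := by
        apply G.map_injective
        simp [← hk]
      rw [← this]
      exact S.downward_closed hg _
    · intro hS
      exact ⟨X, 𝟙 X, 𝟙 _, hS, by simp⟩
  exact ⟨(sheafBotEquivalence (Type u)).symm.trans
    ((Functor.IsDenseSubsite.sheafEquiv (⊥ : GrothendieckTopology A)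
      (⊥ : GrothendieckTopology B) G (Type u)).trans (sheafBotEquivalence (Type u)))⟩

theorem yoneda_separator_aux {C : Type u} [SmallCategory C] {Q : Cᵒᵖ ⥤ Type u}
    (hQ : IsSeparator Q) (c : C) :
    ∃ (i : yoneda.obj c ⟶ Q) (r : Q ⟶ yoneda.obj c), i ≫ r = 𝟙 _ := by
  let S : Subfunctor (yoneda.obj c) :=
    { obj := fun U => {x | ∃ (r : Q ⟶ yoneda.obj c) (q : Q.obj U), r.app U q = x}
      map := by
        rintro U V f x ⟨r, q, rfl⟩
        exact ⟨r, Q.map f q, by rw [NatTrans.naturality_apply]⟩ }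
  have hepi : Epi S.ι := by
    constructor
    intro Z f g hfg
    refine hQ.def f g fun h => ?_
    ext U q
    have := congrArg (fun t => t.app U ⟨h.app U q, h, q, rfl⟩) hfg
    exact this
  have hs : Function.Surjective (S.ι.app (op c)) := by
    rw [← epi_iff_surjective]; infer_instance
  obtain ⟨⟨x, r, q, hx⟩, hx'⟩ := hs (𝟙 c)
  refine ⟨yonedaEquiv.symm q, r, ?_⟩
  rw [yonedaEquiv_symm_naturality_right, Equiv.symm_apply_eq]
  rw [hx]
  simpa [yonedaEquiv] using hx'

/-- The coproduct of representables covering `Q`. -/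
def coverPsh {C : Type u} [SmallCategory C] (Q : Cᵒᵖ ⥤ Type u) : Cᵒᵖ ⥤ Type u where
  obj d := Σ i : (Σ c : C, Q.obj (op c)), (d.unop ⟶ i.1)
  map f := ↾fun x => ⟨x.1, f.unop ≫ x.2⟩

def coverPshHom {C : Type u} [SmallCategory C] (Q : Cᵒᵖ ⥤ Type u) : coverPsh Q ⟶ Q where
  app d := ↾fun x => Q.map x.2.op x.1.2
  naturality d e f := by
    ext x
    change Q.map (f.unop ≫ x.2).op x.1.2 = Q.map f (Q.map x.2.op x.1.2)
    simp

theorem isColimit_compl {D : Type u} [SmallCategory D] {Q : D ⥤ Type u}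
    (A B : Subfunctor Q) (hAB : ∀ U (x : Q.obj U), x ∈ B.obj U ↔ x ∉ A.obj U) :
    Nonempty (IsColimit (BinaryCofan.mk A.ι B.ι)) := by
  classical
  have hmapB : ∀ {U V : D} (f : U ⟶ V) (x : Q.obj U), x ∉ A.obj U → Q.map f x ∉ A.obj V :=
    fun f x hx => (hAB _ _).1 (B.map f ((hAB _ _).2 hx))
  refine ⟨BinaryCofan.isColimitMk (fun s =>
    { app := fun U => ↾fun x => if h : x ∈ A.obj U then s.inl.app U ⟨x, h⟩
        else s.inr.app U ⟨x, (hAB _ _).2 h⟩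
      naturality := ?_ }) ?_ ?_ ?_⟩
  · intro U V f
    ext x
    by_cases h : x ∈ A.obj U
    · have h' : Q.map f x ∈ A.obj V := A.map f h
      have := NatTrans.naturality_apply s.inl f ⟨x, h⟩
      exact ((dif_pos h').trans this).trans (congrArg (s.pt.map f) (dif_pos h).symm)
    · have h' := hmapB f x h
      have := NatTrans.naturality_apply s.inr f ⟨x, (hAB _ _).2 h⟩
      exact ((dif_neg h').trans this).trans (congrArg (s.pt.map f) (dif_neg h).symm)
  · intro s
    ext U ⟨x, hx⟩
    exact dif_pos hx
  · intro s
    ext U ⟨x, hx⟩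
    have := (hAB _ _).1 hx
    exact dif_neg this
  · intro s m h1 h2
    ext U x
    by_cases h : x ∈ A.obj U
    · refine Eq.trans ?_ (dif_pos h).symm
      rw [← h1]; rfl
    · refine Eq.trans ?_ (dif_neg h).symm
      rw [← h2]; rfl

theorem retract_of_indec {C : Type u} [SmallCategory C] {Q : Cᵒᵖ ⥤ Type u}
    (hI : Indecomposable Q) (hP : Projective Q) :
    ∃ (c : C) (i : Q ⟶ yoneda.obj c) (r : yoneda.obj c ⟶ Q), i ≫ r = 𝟙 _ := by
  have hne : ∃ (d : Cᵒᵖ), Nonempty (Q.obj d) := by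
    by_contra hcon
    push Not at hcon
    refine hI.1 (IsInitial.ofUniqueHom (fun Y =>
      { app := fun d => ↾fun x => (hcon d).elim x
        naturality := fun d e f => by ext x; exact (hcon d).elim x }) ?_)
    intro Y m
    ext d x
    exact (hcon d).elim x
  obtain ⟨d, ⟨x₀⟩⟩ := hne
  have hepi : Epi (coverPshHom Q) := by
    rw [NatTrans.epi_iff_epi_app]
    intro k
    rw [epi_iff_surjective]
    intro x
    exact ⟨⟨⟨k.unop, x⟩, 𝟙 _⟩, by simp [coverPshHom]⟩
  let s : Q ⟶ coverPsh Q := Projective.factorThru (𝟙 Q) (coverPshHom Q)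
  have hs : s ≫ coverPshHom Q = 𝟙 Q := Projective.factorThru_comp _ _
  have hmap : ∀ {U V : Cᵒᵖ} (f : U ⟶ V) (x : Q.obj U),
      s.app V (Q.map f x) = ⟨(s.app U x).1, f.unop ≫ (s.app U x).2⟩ := by
    intro U V f x
    rw [NatTrans.naturality_apply]
    rfl
  let i₀ := (s.app d x₀).1
  let A : Subfunctor Q :=
    { obj := fun U => {x | (s.app U x).1 = i₀}
      map := by
        intro U V f x hx
        have hx' : (s.app U x).1 = i₀ := hx
        change (s.app V (Q.map f x)).1 = i₀
        rw [hmap]; exact hx' }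
  let B : Subfunctor Q :=
    { obj := fun U => {x | ¬ (s.app U x).1 = i₀}
      map := by
        intro U V f x hx
        have hx' : ¬ (s.app U x).1 = i₀ := hx
        change ¬ (s.app V (Q.map f x)).1 = i₀
        rw [hmap]; exact hx' }
  obtain ⟨hcol⟩ := isColimit_compl A B (fun U x => Iff.rfl)
  let e : Q ≅ A.toFunctor ⨿ B.toFunctor :=
    hcol.coconePointUniqueUpToIso (colimit.isColimit (pair A.toFunctor B.toFunctor))
  have he1 : A.ι ≫ e.hom = coprod.inl :=
    hcol.comp_coconePointUniqueUpToIso_hom (colimit.isColimit (pair A.toFunctor B.toFunctor)) ⟨WalkingPair.left⟩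
  have he2 : B.ι ≫ e.hom = coprod.inr :=
    hcol.comp_coconePointUniqueUpToIso_hom (colimit.isColimit (pair A.toFunctor B.toFunctor)) ⟨WalkingPair.right⟩
  have hA : ∀ (U : Cᵒᵖ) (x : Q.obj U), (s.app U x).1 = i₀ := by
    rcases hI.2 _ _ ⟨e⟩ with h | h
    · rw [← he1] at h
      have : IsIso A.ι := IsIso.of_isIso_comp_right A.ι e.hom
      have htop := (Subfunctor.eq_top_iff_isIso A).2 this
      intro U x
      have : x ∈ A.obj U := by rw [htop]; trivial
      exact this
    · rw [← he2] at h
      have : IsIso B.ι := IsIso.of_isIso_comp_right B.ι e.hom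
      have htop := (Subfunctor.eq_top_iff_isIso B).2 this
      have : x₀ ∈ B.obj d := by rw [htop]; trivial
      exact absurd rfl this
  have hex : ∀ (U : Cᵒᵖ) (x : Q.obj U), ∃ f : U.unop ⟶ i₀.1, s.app U x = ⟨i₀, f⟩ := by
    intro U x
    have h := hA U x
    generalize s.app U x = y at h
    obtain ⟨j, f⟩ := y
    obtain rfl : j = i₀ := h
    exact ⟨f, rfl⟩
  choose φ hφ using hex
  refine ⟨i₀.1, { app := fun U => ↾(φ U), naturality := ?_ }, yonedaEquiv.symm i₀.2, ?_⟩
  · intro U V f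
    ext x
    have h1 := hφ V (Q.map f x)
    rw [hmap, hφ U x] at h1
    have := eq_of_heq (Sigma.mk.inj h1).2
    exact this.symm
  · ext U x
    have h1 := congrArg (fun t => t.app U x) hs
    have h2 : (coverPshHom Q).app U (s.app U x) = x := h1
    rw [hφ] at h2
    exact h2

theorem indec_yoneda {C : Type w} [Category.{u} C] (c : C) :
    Indecomposable (yoneda.obj c) := by
  constructor
  · intro h
    let E : Cᵒᵖ ⥤ Type u := (Functor.const _).obj PEmpty
    exact PEmpty.elim ((h.to E).app (op c) (𝟙 c))
  · rintro A B ⟨e⟩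
    obtain ⟨j, y, hy⟩ := FunctorToTypes.jointly_surjective (pair A B) (op c)
      (coprodIsCoprod A B) (yonedaEquiv e.hom)
    rcases j with ⟨_ | _⟩
    · left
      change A.obj (op c) at y
      have hy' : (coprod.inl : A ⟶ A ⨿ B).app (op c) y = yonedaEquiv e.hom := hy.symm
      have h : (e.inv ≫ (yonedaEquiv (F := A)).symm y) ≫ (coprod.inl : A ⟶ A ⨿ B) = 𝟙 _ := by
        rw [Category.assoc, yonedaEquiv_symm_naturality_right, hy']
        simp
      have : IsSplitEpi (coprod.inl : A ⟶ A ⨿ B) := ⟨⟨_, h⟩⟩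
      exact isIso_of_mono_of_isSplitEpi _
    · right
      change B.obj (op c) at y
      have hy' : (coprod.inr : B ⟶ A ⨿ B).app (op c) y = yonedaEquiv e.hom := hy.symm
      have h : (e.inv ≫ (yonedaEquiv (F := B)).symm y) ≫ (coprod.inr : B ⟶ A ⨿ B) = 𝟙 _ := by
        rw [Category.assoc, yonedaEquiv_symm_naturality_right, hy']
        simp
      have : IsSplitEpi (coprod.inr : B ⟶ A ⨿ B) := ⟨⟨_, h⟩⟩
      exact isIso_of_mono_of_isSplitEpi _

theorem proj_yoneda {C : Type w} [Category.{u} C] (c : C) :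
    Projective (yoneda.obj c) := by
  constructor
  intro E X f e he
  have hs : Function.Surjective (e.app (op c)) := by
    rw [← epi_iff_surjective]; infer_instance
  obtain ⟨y, hy⟩ := hs (yonedaEquiv f)
  refine ⟨yonedaEquiv.symm y, ?_⟩
  rw [yonedaEquiv_symm_naturality_right, hy]
  simp

theorem sep_yoneda (M : Type u) [Monoid M] :
    IsSeparator (yoneda.obj (SingleObj.star M) : PSh M) := by
  rw [isSeparator_def]
  intro X Y f g h
  ext ⟨U⟩ x
  have := congrArg yonedaEquiv (h ((yonedaEquiv (X := SingleObj.star M)).symm x))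
  simp [yonedaEquiv_comp] at this
  exact this

theorem indec_of_equiv {C D : Type*} [Category C] [Category D] [HasBinaryCoproducts C]
    [HasBinaryCoproducts D] (e : C ≌ D) {Q : C} (hQ : Indecomposable Q) :
    Indecomposable (e.functor.obj Q) := by
  constructor
  · intro h
    exact hQ.1 (IsInitial.isInitialOfObj e.functor Q h)
  · rintro A B ⟨φ⟩
    let k := PreservesColimitPair.iso e.inverse A B
    have h1 : coprod.inl ≫ k.hom = e.inverse.map (coprod.inl : A ⟶ A ⨿ B) := by simp [k]
    have h2 : coprod.inr ≫ k.hom = e.inverse.map (coprod.inr : B ⟶ A ⨿ B) := by simp [k]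
    rcases hQ.2 _ _ ⟨e.unitIso.app Q ≪≫ e.inverse.mapIso φ ≪≫ k.symm⟩ with h | h
    · left
      have : IsIso (e.inverse.map (coprod.inl : A ⟶ A ⨿ B)) := by
        rw [← h1]; infer_instance
      exact isIso_of_reflects_iso _ e.inverse
    · right
      have : IsIso (e.inverse.map (coprod.inr : B ⟶ A ⨿ B)) := by
        rw [← h2]; infer_instance
      exact isIso_of_reflects_iso _ e.inverse

/-- The presheaf category on a small category `C` is equivalent to the category of right
`M`-sets for some monoid `M` if and only if it has an indecomposable projective
separator. -/
theorem presheaves_equiv_psh_iff (C : Type u) [SmallCategory C] :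
    (∃ (M : Type u) (_ : Monoid M), Nonempty ((Cᵒᵖ ⥤ Type u) ≌ PSh M)) ↔
      ∃ Q : Cᵒᵖ ⥤ Type u, Indecomposable Q ∧ Projective Q ∧ IsSeparator Q := by
  constructor
  · rintro ⟨M, _, ⟨e⟩⟩
    refine ⟨e.symm.functor.obj (yoneda.obj (SingleObj.star M)), ?_, ?_, ?_⟩
    · exact indec_of_equiv e.symm (indec_yoneda _)
    · exact (e.symm.map_projective_iff _).2 (proj_yoneda _)
    · exact (sep_yoneda M).of_equivalence e.symm
  · rintro ⟨Q, hI, hP, hS⟩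
    obtain ⟨c, i, r, hir⟩ := retract_of_indec hI hP
    let F : Option C → (Cᵒᵖ ⥤ Type u) := fun o => o.elim Q yoneda.obj
    let G₁ : C ⥤ InducedCategory _ F :=
      { obj := fun c => (some c : Option C)
        map := fun f => InducedCategory.homMk (yoneda.map f)
        map_id := fun X => InducedCategory.hom_ext (yoneda.map_id X)
        map_comp := fun f g => InducedCategory.hom_ext (yoneda.map_comp f g) }
    let q : InducedCategory _ F := (none : Option C)
    let G₂ : SingleObj (End q) ⥤ InducedCategory _ F := SingleObj.functor (MonoidHom.id _)
    have : G₁.Full := ⟨fun {X Y} f => ⟨yoneda.preimage f.hom,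
      InducedCategory.hom_ext (yoneda.map_preimage (X := X) (Y := Y) f.hom)⟩⟩
    have : G₁.Faithful := ⟨fun {X Y} f g h => yoneda.map_injective
      (congrArg (fun t : G₁.obj X ⟶ G₁.obj Y => t.hom) h)⟩
    have : G₂.Full := ⟨fun f => ⟨f, rfl⟩⟩
    have : G₂.Faithful := ⟨fun h => h⟩
    obtain ⟨E₁⟩ := psh_equiv_of_retract G₁ (by
      intro b
      cases b with
      | none => exact ⟨c, InducedCategory.homMk i, InducedCategory.homMk r,
          InducedCategory.hom_ext hir⟩
      | some b => exact ⟨b, 𝟙 _, 𝟙 _, Category.id_comp _⟩)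
    obtain ⟨E₂⟩ := psh_equiv_of_retract (A := SingleObj (End q))
        (B := InducedCategory _ F) G₂ (by
      intro b
      cases b with
      | none => exact ⟨SingleObj.star _, 𝟙 _, 𝟙 _, Category.id_comp _⟩
      | some b =>
        obtain ⟨i', r', h'⟩ := yoneda_separator_aux hS b
        exact ⟨SingleObj.star _, InducedCategory.homMk i', InducedCategory.homMk r',
          InducedCategory.hom_ext h'⟩)
    exact ⟨End q, inferInstance, ⟨E₁.trans E₂.symm⟩⟩
end

section
/- For any monoid M, the representable presheaf at the unique object of SingleObj M (that is, M acting on itself by right multiplication) is an indecomposable projective separator of the category of right M-sets PSh(M). -/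
open CategoryTheory CategoryTheory.Limits

universe u

/-- The representable presheaf at the unique object of `SingleObj M` (that is, `M` acting
on itself by right multiplication) is an indecomposable projective separator of the
category of right `M`-sets. -/
theorem representable_indecomposable_projective_separator (M : Type u) [Monoid M] :
    Indecomposable (yoneda.obj (SingleObj.star M) : PSh M) ∧
    Projective (yoneda.obj (SingleObj.star M) : PSh M) ∧
    IsSeparator (yoneda.obj (SingleObj.star M) : PSh M) := by
  refine ⟨⟨?_, ?_⟩, ?_, ?_⟩
  · intro h
    let f := h.to ((Functor.const _).obj PEmpty)
    exact (f.app (Opposite.op (SingleObj.star M)) (𝟙 _)).elim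
  · rintro A B ⟨e⟩
    obtain ⟨⟨j⟩, y, hy⟩ := FunctorToTypes.jointly_surjective (pair A B)
      (Opposite.op (SingleObj.star M)) (colimit.isColimit (pair A B)) (yonedaEquiv e.hom)
    cases j with
    | left =>
      left
      obtain ⟨s, h⟩ : ∃ s : yoneda.obj (SingleObj.star M) ⟶ A,
          s ≫ (coprod.inl : A ⟶ A ⨿ B) = e.hom := by
        change A.obj (Opposite.op (SingleObj.star M)) at y
        refine ⟨yonedaEquiv.symm y, ?_⟩
        apply yonedaEquiv.injective
        rw [yonedaEquiv_comp, Equiv.apply_symm_apply]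
        exact hy.symm
      have : IsSplitEpi (coprod.inl : A ⟶ A ⨿ B) :=
        ⟨⟨⟨e.inv ≫ s, by rw [Category.assoc, h, e.inv_hom_id]⟩⟩⟩
      exact isIso_of_mono_of_isSplitEpi _
    | right =>
      right
      obtain ⟨s, h⟩ : ∃ s : yoneda.obj (SingleObj.star M) ⟶ B,
          s ≫ (coprod.inr : B ⟶ A ⨿ B) = e.hom := by
        change B.obj (Opposite.op (SingleObj.star M)) at y
        refine ⟨yonedaEquiv.symm y, ?_⟩
        apply yonedaEquiv.injective
        rw [yonedaEquiv_comp, Equiv.apply_symm_apply]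
        exact hy.symm
      have : IsSplitEpi (coprod.inr : B ⟶ A ⨿ B) :=
        ⟨⟨⟨e.inv ≫ s, by rw [Category.assoc, h, e.inv_hom_id]⟩⟩⟩
      exact isIso_of_mono_of_isSplitEpi _
  · constructor
    intro E X f e _
    have := (NatTrans.epi_iff_epi_app e).1 inferInstance (Opposite.op (SingleObj.star M))
    rw [CategoryTheory.epi_iff_surjective] at this
    obtain ⟨a, ha⟩ := this (yonedaEquiv f)
    refine ⟨yonedaEquiv.symm a, yonedaEquiv.injective ?_⟩
    rw [yonedaEquiv_comp]
    simpa using ha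
  · rw [isSeparator_def]
    intro X Y f g h
    ext ⟨⟨⟩⟩ x
    have := congrArg yonedaEquiv (h (yonedaEquiv.symm x))
    rw [yonedaEquiv_comp, yonedaEquiv_comp, Equiv.apply_symm_apply] at this
    exact this
end

section
/- Let M be a monoid and e an idempotent of M. There is a fully faithful functor from Karoubi (SingleObj (eMe)) to Karoubi (SingleObj M), sending the object of the Karoubi envelope determined by an idempotent f of eMe to the object (⋆, f) of Karoubi (SingleObj M), and acting as the inclusion eMe ⊆ M on morphisms. -/
open CategoryTheory CategoryTheory.Idempotents

universe u

/-- The corner monoid `eMe` of a monoid `M` at an idempotent `e`: the elements `m` of `M`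
with `e * m = m` and `m * e = m`, with multiplication inherited from `M` and identity
element `e`. -/
def Corner (M : Type u) [Monoid M] (e : M) (he : e * e = e) : Type u :=
  {m : M // e * m = m ∧ m * e = m}

instance Corner.monoid (M : Type u) [Monoid M] (e : M) (he : e * e = e) :
    Monoid (Corner M e he) where
  mul a b := ⟨a.1 * b.1,
    by rw [← mul_assoc, a.2.1], by rw [mul_assoc, b.2.2]⟩
  one := ⟨e, he, he⟩
  one_mul a := Subtype.ext a.2.1
  mul_one a := Subtype.ext a.2.2
  mul_assoc a b c := Subtype.ext (mul_assoc a.1 b.1 c.1)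

def cornerKaroubiFunctor (M : Type u) [Monoid M] (e : M) (he : e * e = e) :
    Karoubi (SingleObj (Corner M e he)) ⥤ Karoubi (SingleObj M) where
  obj P := ⟨SingleObj.star M, Subtype.val (P.p : Corner M e he),
    congrArg (Subtype.val : Corner M e he → M) P.idem⟩
  map g := ⟨Subtype.val (g.f : Corner M e he),
    congrArg (Subtype.val : Corner M e he → M) g.comm⟩
  map_id _ := rfl
  map_comp _ _ := rfl

theorem corner_full_aux {M : Type u} [Monoid M] {e p q h : M}
    (hp : p * e = p) (hq : e * q = q) (hh : (q * h) * p = h) : e * h = h ∧ h * e = h := by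
  constructor
  · rw [← hh, ← mul_assoc, ← mul_assoc, hq]
  · rw [← hh, mul_assoc, hp]

/-- For an idempotent `e` of a monoid `M`, there is a fully faithful functor from the
Karoubi envelope of the one-object category on the corner monoid `eMe` to the Karoubi
envelope of the one-object category on `M`, sending the object determined by an
idempotent `f` of `eMe` to the object `(⋆, f)` of `Karoubi (SingleObj M)` and acting as
the inclusion `eMe ⊆ M` on morphisms. -/
theorem corner_karoubi_fully_faithful (M : Type u) [Monoid M] (e : M) (he : e * e = e) :
    ∃ F : Karoubi (SingleObj (Corner M e he)) ⥤ Karoubi (SingleObj M),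
      F.Full ∧ F.Faithful ∧
      (∀ P : Karoubi (SingleObj (Corner M e he)),
        (F.obj P).p = Subtype.val (P.p : Corner M e he)) ∧
      (∀ (P Q : Karoubi (SingleObj (Corner M e he))) (g : P ⟶ Q),
        (F.map g).f = Subtype.val (g.f : Corner M e he)) := by
  refine ⟨cornerKaroubiFunctor M e he, ⟨?_⟩, ⟨?_⟩, fun _ => rfl, fun _ _ _ => rfl⟩
  · intro P Q h
    have hc : (Subtype.val (Q.p : Corner M e he) * (h.f : M)) *
        Subtype.val (P.p : Corner M e he) = (h.f : M) := by
      have := h.comm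
      exact this
    have hm := corner_full_aux (Subtype.property (P.p : Corner M e he)).2
      (Subtype.property (Q.p : Corner M e he)).1 hc
    refine ⟨⟨(⟨h.f, hm⟩ : Corner M e he), Subtype.ext ?_⟩, rfl⟩
    exact hc
  · intro P Q a b hab
    apply Karoubi.hom_ext
    exact Subtype.ext (congrArg Karoubi.Hom.f hab)
end

section
/- Two monoids M and N are Morita equivalent, i.e. Nonempty (PSh(M) ≌ PSh(N)), if and only if there exist elements e, β, β' of M such that e is idempotent (e * e = e), β * β' = 1, β * e = β, and N is isomorphic as a monoid to the corner monoid eMe. -/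
open CategoryTheory

universe u

set_option linter.unusedSimpArgs false

namespace MoritaAux

section basic
variable {M : Type u} [Monoid M]

/-- carrier -/
def Car (X : PSh M) : Type u := X.obj (Opposite.op (SingleObj.star M))

/-- a monoid element as an arrow -/
def arr (m : M) : SingleObj.star M ⟶ SingleObj.star M := m

/-- right action -/
def act (X : PSh M) (x : Car X) (m : M) : Car X := X.map (arr m).op x

theorem act_one (X : PSh M) (x : Car X) : act X x 1 = x := by
  have h := X.map_id (Opposite.op (SingleObj.star M))
  exact congrArg (fun g => (ConcreteCategory.hom g) x) h

theorem act_mul (X : PSh M) (x : Car X) (m n : M) :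
    act X x (m * n) = act X (act X x m) n := by
  have h := X.map_comp (arr m).op (arr n).op
  exact congrArg (fun g => (ConcreteCategory.hom g) x) h

/-- underlying map -/
def ap {X Y : PSh M} (f : X ⟶ Y) (x : Car X) : Car Y :=
  f.app (Opposite.op (SingleObj.star M)) x

theorem ap_act {X Y : PSh M} (f : X ⟶ Y) (x : Car X) (m : M) :
    ap f (act X x m) = act Y (ap f x) m := by
  have h := f.naturality (arr m).op
  exact congrArg (fun g => (ConcreteCategory.hom g) x) h

theorem ap_comp {X Y Z : PSh M} (f : X ⟶ Y) (g : Y ⟶ Z) (x : Car X) :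
    ap (f ≫ g) x = ap g (ap f x) := rfl

theorem hext {X Y : PSh M} {f g : X ⟶ Y} (h : ∀ x, ap f x = ap g x) : f = g := by
  apply NatTrans.ext
  funext ⟨⟨⟩⟩
  apply ConcreteCategory.hom_ext
  exact h

/-- constructor for objects -/
def mkP (A : Type u) (f : A → M → A) (h1 : ∀ a, f a 1 = a)
    (hm : ∀ a m n, f a (m * n) = f (f a m) n) : PSh M where
  obj _ := A
  map m := TypeCat.ofHom fun a => f a (m.unop : M)
  map_id _ := by
    apply ConcreteCategory.hom_ext
    exact h1
  map_comp p q := by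
    apply ConcreteCategory.hom_ext
    intro a
    exact hm a p.unop q.unop

/-- constructor for morphisms -/
def mkH {X Y : PSh M} (g : Car X → Car Y)
    (hg : ∀ x m, g (act X x m) = act Y (g x) m) : X ⟶ Y where
  app _ := TypeCat.ofHom g
  naturality p q m := by
    apply ConcreteCategory.hom_ext
    intro a
    exact hg a m.unop

theorem ap_mkH {X Y : PSh M} (g : Car X → Car Y)
    (hg : ∀ x m, g (act X x m) = act Y (g x) m) (x : Car X) : ap (mkH g hg) x = g x := rfl

variable (M) in
/-- the regular right M-set -/
def reg : PSh M := mkP M (fun a m => a * m) mul_one (fun a m n => (mul_assoc a m n).symm)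

/-- map out of the regular M-set -/
def out (X : PSh M) (x : Car X) : reg M ⟶ X :=
  mkH (X := reg M) (fun m => act X x m) (fun a m => act_mul X x a m)

/-- evaluation at one -/
def ev {X : PSh M} (f : reg M ⟶ X) : Car X := ap f (1 : M)

theorem ap_out (X : PSh M) (x : Car X) (m : M) : ap (out X x) m = act X x m := rfl

theorem ap_reg {X : PSh M} (f : reg M ⟶ X) (m : M) : ap f m = act X (ev f) m := by
  have h : act (reg M) (1 : M) m = m := one_mul m
  exact (congrArg (ap f) h.symm).trans (ap_act f (1 : M) m)

theorem ev_out (X : PSh M) (x : Car X) : ev (out X x) = x := act_one X x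

theorem ev_inj {X : PSh M} {f g : reg M ⟶ X} (h : ev f = ev g) : f = g :=
  hext fun m => by rw [ap_reg f m, ap_reg g m, h]

theorem ev_comp {X : PSh M} (f : reg M ⟶ reg M) (g : reg M ⟶ X) :
    ev (f ≫ g) = act X (ev g) (ev f) := ap_reg g (ev f)

/-- value at one as an element of M -/
def evM (f : reg M ⟶ reg M) : M := ev f

theorem evM_comp (f g : reg M ⟶ reg M) : evM (f ≫ g) = evM g * evM f := ev_comp f g

theorem evM_id : evM (𝟙 (reg M)) = 1 := rfl

theorem evM_inj {f g : reg M ⟶ reg M} (h : evM f = evM g) : f = g := ev_inj h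

theorem evM_out (m : M) : evM (out (reg M) m) = m := ev_out (reg M) m

end basic

section forward
variable {M N : Type u} [Monoid M] [Monoid N]

variable (N) in
/-- the N-set of subsets of N -/
def pow : PSh N := mkP (Set N) (fun S n => {m | n * m ∈ S})
  (fun a => by ext; simp) (fun a m n => by ext; simp [mul_assoc])

theorem retract (E : PSh M ≌ PSh N) :
    ∃ (s : reg N ⟶ E.functor.obj (reg M)) (r : E.functor.obj (reg M) ⟶ reg N),
      s ≫ r = 𝟙 _ := by
  suffices H : ∃ (r : E.functor.obj (reg M) ⟶ reg N) (y : Car (E.functor.obj (reg M))),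
      ap r y = (1 : N) by
    obtain ⟨r, y, h⟩ := H
    refine ⟨out _ y, r, ev_inj ?_⟩
    exact (congrArg (ap r) (act_one _ y)).trans h
  let I : Set N := {n | ∃ (r : E.functor.obj (reg M) ⟶ reg N)
    (y : Car (E.functor.obj (reg M))), ap r y = n}
  change (1 : N) ∈ I
  have hI : ∀ n ∈ I, ∀ m, n * m ∈ I := by
    rintro n ⟨r, y, rfl⟩ m
    exact ⟨r, act _ y m, ap_act r y m⟩
  have key : ∀ h : E.functor.obj (reg M) ⟶ reg N,
      h ≫ out (pow N) I = h ≫ out (pow N) (Set.univ : Set N) := by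
    intro h
    apply hext
    intro y
    let z : N := ap h y
    have hz : z ∈ I := ⟨h, y, rfl⟩
    have : ({m | z * m ∈ I} : Set N) = {m | z * m ∈ Set.univ} := by
      ext m
      exact ⟨fun _ => trivial, fun _ => hI _ hz m⟩
    exact this
  have e2 : E.inverse.map (out (pow N) I) = E.inverse.map (out (pow N) (Set.univ : Set N)) := by
    apply hext
    intro x
    have h3 : out _ x ≫ E.inverse.map (out (pow N) I)
        = out _ x ≫ E.inverse.map (out (pow N) (Set.univ : Set N)) := by
      apply (E.toAdjunction.homEquiv _ _).symm.injective
      rw [E.toAdjunction.homEquiv_naturality_right_symm,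
        E.toAdjunction.homEquiv_naturality_right_symm]
      exact key _
    have h4 := congrArg ev h3
    have h5 : ∀ g : E.inverse.obj (reg N) ⟶ E.inverse.obj (pow N),
        ev (out _ x ≫ g) = ap g x := fun g => congrArg (ap g) (ev_out _ x)
    rwa [h5, h5] at h4
  have e3 := E.inverse.map_injective e2
  have e4 : I = Set.univ := by
    have := congrArg ev e3
    exact ((ev_out (pow N) I).symm.trans this).trans (ev_out (pow N) (Set.univ : Set N))
  rw [e4]; trivial

theorem forward (E : PSh M ≌ PSh N) : ∃ (e β β' : M) (he : e * e = e),
        β * β' = 1 ∧ β * e = β ∧ Nonempty (N ≃* Corner M e he) := by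
  obtain ⟨a, b, hab⟩ := retract E.symm
  obtain ⟨s₀, r₀, h₀⟩ := retract E
  let P : PSh M := E.inverse.obj (reg N)
  change reg M ⟶ P at a
  change P ⟶ reg M at b
  let s : P ⟶ reg M := E.inverse.map s₀ ≫ E.unitInv.app (reg M)
  let r : reg M ⟶ P := E.unit.app (reg M) ≫ E.inverse.map r₀
  have hsr : s ≫ r = 𝟙 P := by
    simp only [s, r, Category.assoc]
    have : E.unitInv.app (reg M) ≫ E.unit.app (reg M) ≫ E.inverse.map r₀ = E.inverse.map r₀ := by
      simp
    rw [this, ← E.inverse.map_comp, h₀, E.inverse.map_id]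
  have hsr' : ∀ {Z : PSh M} (g : P ⟶ Z), s ≫ r ≫ g = g := fun g => by
    rw [← Category.assoc, hsr, Category.id_comp]
  have he : evM (r ≫ s) * evM (r ≫ s) = evM (r ≫ s) := by
    rw [← evM_comp, Category.assoc, hsr']
  refine ⟨evM (r ≫ s), evM (r ≫ b), evM (a ≫ s), he, ?_, ?_, ⟨?_⟩⟩
  · rw [← evM_comp, Category.assoc, hsr', ← evM_id]
    exact congrArg evM hab
  · rw [← evM_comp, Category.assoc, hsr']
  · let f : N → Corner M _ he := fun n =>
      ⟨evM (r ≫ E.inverse.map (out (reg N) n) ≫ s), by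
        rw [← evM_comp]; simp only [Category.assoc, hsr'], by
        rw [← evM_comp]; simp only [Category.assoc, hsr']⟩
    refine MulEquiv.ofBijective (⟨f, ?_⟩ : N →ₙ* Corner M _ he) ⟨?_, ?_⟩
    · intro m n
      apply Subtype.ext
      change evM (r ≫ E.inverse.map (out (reg N) (m * n)) ≫ s) =
        evM (r ≫ E.inverse.map (out (reg N) m) ≫ s) * evM (r ≫ E.inverse.map (out (reg N) n) ≫ s)
      have : out (reg N) (m * n) = out (reg N) n ≫ out (reg N) m := by
        apply evM_inj
        rw [evM_comp, evM_out, evM_out, evM_out]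
      rw [← evM_comp, this, E.inverse.map_comp]
      simp only [Category.assoc, hsr']
    · intro m n h
      have h1 : evM (r ≫ E.inverse.map (out (reg N) m) ≫ s) =
        evM (r ≫ E.inverse.map (out (reg N) n) ≫ s) := congrArg Subtype.val h
      have h2 := congrArg (fun g => s ≫ g ≫ r) (evM_inj h1)
      simp only [Category.assoc, hsr', hsr] at h2
      erw [Category.comp_id, Category.comp_id] at h2
      have h3 := congrArg evM (E.inverse.map_injective h2)
      rwa [evM_out, evM_out] at h3
    · intro c
      obtain ⟨g, hg⟩ := E.inverse.map_surjective (s ≫ out (reg M) c.1 ≫ r)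
      refine ⟨evM g, Subtype.ext ?_⟩
      have : out (reg N) (evM (M := N) g) = g := evM_inj (evM_out (M := N) _)
      change evM (r ≫ E.inverse.map (out (reg N) (evM (M := N) g)) ≫ s) = c.1
      rw [this, hg]
      have : r ≫ (s ≫ out (reg M) c.1 ≫ r) ≫ s = (r ≫ s) ≫ out (reg M) c.1 ≫ (r ≫ s) := by
        simp only [Category.assoc]
      rw [this, evM_comp, evM_comp, evM_out, c.2.1, c.2.2]

end forward

section backward
variable {M N : Type u} [Monoid M] [Monoid N] (e β β' : M)
  (i : N → M) (hi1 : i 1 = e) (him : ∀ a b, i (a * b) = i a * i b)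

/-- fixed points of e -/
def FObj (X : PSh M) : PSh N :=
  mkP {x : Car X // act X x e = x}
    (fun x n => ⟨act X x.1 (i n), by
      rw [← act_mul, show i n * e = i n by rw [← hi1, ← him, mul_one]]⟩)
    (fun x => Subtype.ext ((congrArg (act X x.1) hi1).trans x.2))
    (fun x m n => Subtype.ext ((congrArg (act X x.1) (him m n)).trans (act_mul _ _ _ _)))

theorem FObj_act (X : PSh M) (x : Car (FObj e i hi1 him X)) (n : N) :
    (act (FObj e i hi1 him X) x n).1 = act X x.1 (i n) := rfl

/-- the restriction functor -/
def FF : PSh M ⥤ PSh N where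
  obj X := FObj e i hi1 him X
  map {X Y} f := mkH (X := FObj e i hi1 him X) (Y := FObj e i hi1 him Y)
    (fun x => ⟨ap f x.1, by rw [← ap_act, x.2]⟩)
    (fun x m => Subtype.ext (ap_act f x.1 (i m)))
  map_id X := rfl
  map_comp f g := rfl

theorem FF_map {X Y : PSh M} (f : X ⟶ Y) (x : Car (FObj e i hi1 him X)) :
    (ap ((FF e i hi1 him).map f) x).1 = ap f x.1 := rfl

variable (hβ : β * β' = 1) (hβe : β * e = β)
  (c : M → N) (hc : ∀ m, i (c m) = e * m * e) (hinj : Function.Injective i)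

include hβ hβe in
theorem FF_faithful : (FF e i hi1 him).Faithful where
  map_injective {X Y f g} h := by
    apply hext
    intro x
    let t : Car (FObj e i hi1 him X) := ⟨act X x β, by rw [← act_mul, hβe]⟩
    have h1 : ap f (act X x β) = ap g (act X x β) :=
      congrArg Subtype.val (congrArg (fun k => ap k t) h)
    have h2 := congrArg (fun y => act Y y β') h1
    simpa only [← ap_act, ← act_mul, hβ, act_one] using h2

include hβ hβe hc in
theorem FF_full : (FF e i hi1 him).Full where
  map_surjective {X Y} g := by
    change FObj e i hi1 him X ⟶ FObj e i hi1 him Y at g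
    let t : Car X → Car (FObj e i hi1 him X) := fun x => ⟨act X x β, by rw [← act_mul, hβe]⟩
    have hβ2 : ∀ z, β * (e * z) = β * z := fun z => by rw [← mul_assoc, hβe]
    have hβ3 : ∀ z, β * (β' * z) = z := fun z => by rw [← mul_assoc, hβ, one_mul]
    have hY : ∀ (y : Car (FObj e i hi1 him Y)) z, act Y y.1 (e * z) = act Y y.1 z := fun y z => by
      rw [act_mul, y.2]
    refine ⟨mkH (fun x => act Y (ap g (t x)).1 β') ?_, ?_⟩
    · intro x m
      have : t (act X x m) = act (FObj e i hi1 him X) (t x) (c (β' * m * β)) := by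
        apply Subtype.ext
        rw [FObj_act, hc]
        change act X (act X x m) β = act X (act X x β) _
        simp only [← act_mul, mul_assoc, hβ2, hβ3, hβe]
      rw [this, ap_act, FObj_act, hc]
      simp only [← act_mul, mul_assoc, hY, hβ2, hβ]
      simp only [hβ, hβ2, mul_one]
    · apply hext
      intro x
      apply Subtype.ext
      change Car (FObj e i hi1 him X) at x
      change act Y (ap g (t x.1)).1 β' = (ap g x).1
      have : t x.1 = act (FObj e i hi1 him X) x (c β) := by
        apply Subtype.ext
        rw [FObj_act, hc]
        change act X x.1 β = _
        rw [mul_assoc, act_mul X _ e, x.2, hβe]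
      rw [this, ap_act, FObj_act, hc]
      rw [← act_mul, mul_assoc, mul_assoc, hY, hβ2, hβ, act_one]

include hβ hβe hc hinj in
theorem FF_essSurj : (FF e i hi1 him).EssSurj where
  mem_essImage Y := by
    have hβ2 : ∀ z, β * (e * z) = β * z := fun z => by rw [← mul_assoc, hβe]
    have hβ3 : ∀ z, β * (β' * z) = z := fun z => by rw [← mul_assoc, hβ, one_mul]
    have hee : e * e = e := by rw [← hi1, ← him, mul_one]
    have hee2 : ∀ z, e * (e * z) = e * z := fun z => by rw [← mul_assoc, hee]
    have hie : ∀ n, i n * e = i n := fun n => by rw [← hi1, ← him, mul_one]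
    have hei : ∀ n, e * i n = i n := fun n => by rw [← hi1, ← him, one_mul]
    have hie2 : ∀ n z, i n * (e * z) = i n * z := fun n z => by rw [← mul_assoc, hie]
    have hei2 : ∀ n z, e * (i n * z) = i n * z := fun n z => by rw [← mul_assoc, hei]
    have hφ : ∀ m n, c (β' * (m * n) * β) = c (β' * m * β) * c (β' * n * β) := by
      intro m n
      apply hinj
      simp only [him, hc, mul_assoc, hβ2, hβ3, hβe, hee2]
    let X : PSh M := mkP {y : Car Y // act Y y (c (β' * 1 * β)) = y}
      (fun y m => ⟨act Y y.1 (c (β' * m * β)), by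
        rw [← act_mul, ← hφ, show m * 1 = m from mul_one m]⟩)
      (fun y => Subtype.ext y.2)
      (fun y m n => Subtype.ext ((congrArg (act Y y.1) (hφ m n)).trans (act_mul _ _ _ _)))
    have q1 : c β * c (β' * 1 * β) = c β := by
      apply hinj
      simp only [him, hc, mul_assoc, hβ2, hβ3, hβe, hee2, one_mul]
    have q2 : c β * c (β' * e * β) = c β := by
      apply hinj
      simp only [him, hc, mul_assoc, hβ2, hβ3, hβe, hee2, one_mul]
    have q3 : c β * c β' = 1 := by
      apply hinj
      simp only [him, hc, mul_assoc, hβ2, hβ3, hβe, hee2, one_mul, hi1, hee]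
    have q4 : c β' * c β = c (β' * e * β) := by
      apply hinj
      simp only [him, hc, mul_assoc, hβ2, hβ3, hβe, hee2, one_mul, hi1, hee]
    have q5 : ∀ n, n * c β = c β * c (β' * i n * β) := by
      intro n
      apply hinj
      simp only [him, hc, mul_assoc, hβ2, hβ3, hβe, hee2, hie2, hei2]
    have q6 : ∀ n, c (β' * i n * β) * c β' = c β' * n := by
      intro n
      apply hinj
      simp only [him, hc, mul_assoc, hβ2, hβ3, hβe, hee2, hie2, hei2, hie, hei]
    let f : Y ⟶ FObj e i hi1 him X := mkH (X := Y) (Y := FObj e i hi1 him X)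
      (fun y => ⟨⟨act Y y (c β), by rw [← act_mul, q1]⟩, Subtype.ext (by
        change act Y (act Y y (c β)) (c (β' * e * β)) = _
        rw [← act_mul, q2])⟩)
      (fun y n => Subtype.ext (Subtype.ext (by
        change act Y (act Y y n) (c β) = act Y (act Y y (c β)) (c (β' * i n * β))
        rw [← act_mul, ← act_mul, q5])))
    let g : FObj e i hi1 him X ⟶ Y := mkH (X := FObj e i hi1 him X) (Y := Y)
      (fun x => act Y x.1.1 (c β'))
      (fun x n => by
        change act Y (act Y x.1.1 (c (β' * i n * β))) (c β') = act Y (act Y x.1.1 (c β')) n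
        rw [← act_mul, ← act_mul, q6])
    refine ⟨X, ⟨⟨g, f, ?_, ?_⟩⟩⟩
    · apply hext
      intro x
      apply Subtype.ext
      apply Subtype.ext
      change act Y (act Y x.1.1 (c β')) (c β) = x.1.1
      rw [← act_mul, q4]
      exact congrArg Subtype.val x.2
    · apply hext
      intro y
      change act Y (act Y y (c β)) (c β') = y
      rw [← act_mul, q3, act_one]

end backward

end MoritaAux

open MoritaAux in
/-- Two monoids `M` and `N` are Morita equivalent (their categories of right actions are
equivalent) if and only if there are elements `e, β, β'` of `M` with `e` idempotent,
`β * β' = 1` and `β * e = β`, such that `N` is isomorphic to the corner monoid `eMe`. -/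
theorem morita_equivalence_iff (M N : Type u) [Monoid M] [Monoid N] :
    Nonempty (PSh M ≌ PSh N) ↔
      ∃ (e β β' : M) (he : e * e = e),
        β * β' = 1 ∧ β * e = β ∧ Nonempty (N ≃* Corner M e he) := by
  constructor
  · rintro ⟨E⟩
    exact forward E
  · rintro ⟨e, β, β', he, hβ, hβe, ⟨ψ⟩⟩
    let i : N → M := fun n => (ψ n).1
    have hi1 : i 1 = e := congrArg Subtype.val (map_one ψ)
    have him : ∀ a b, i (a * b) = i a * i b := fun a b => congrArg Subtype.val (map_mul ψ a b)
    let c : M → N := fun m => ψ.symm ⟨e * m * e, by rw [← mul_assoc, ← mul_assoc, he], by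
      rw [mul_assoc, he]⟩
    have hc : ∀ m, i (c m) = e * m * e := fun m => congrArg Subtype.val (ψ.apply_symm_apply _)
    have hinj : Function.Injective i := fun a b h => ψ.injective (Subtype.ext h)
    have := FF_faithful e β β' i hi1 him hβ hβe
    have := FF_full e β β' i hi1 him hβ hβe c hc
    have := FF_essSurj e β β' i hi1 him hβ hβe c hc hinj
    have : (FF e i hi1 him).IsEquivalence := {}
    exact ⟨(FF e i hi1 him).asEquivalence⟩
end
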